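/- Fix positive integers k and t with k ≥ 2t+3. There exist constants c₁, c₂ > 0, depending only on k and t, such that for every function r : ℕ → ℕ with r(n) ≥ 1 for all n and r(n)/n^{k-t-1} → 0 as n → ∞, there exists n₀ such that for all n > n₀: c₁ · r(n) · n^{k-2t-1} ≤ ρ_{n,k,t}(C(n-t-1,k-t-1) + r(n)) ≤ c₂ · r(n) · n^{k-2t-1}. -/

import Mathlib

/-- The number of unordered pairs of distinct sets `F₁, F₂ ∈ F` with `|F₁ ∩ F₂| = t`. -/
def rhoPairs (t : ℕ) (F : Finset (Finset ℕ)) : ℕ :=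
  ((F.powersetCard 2).filter
    (fun P => ∃ A ∈ P, ∃ B ∈ P, A ≠ B ∧ (A ∩ B).card = t)).card

/-- `ρ_{n,k,t}(ℓ)`: the minimum of `ρ(F)` over families `F` of `k`-element subsets
of `[n]` with `|F| = ℓ`. -/
noncomputable def rhoMin (n k t ℓ : ℕ) : ℕ :=
  sInf { m : ℕ | ∃ F : Finset (Finset ℕ),
    F ⊆ (Finset.Icc 1 n).powersetCard k ∧ F.card = ℓ ∧ rhoPairs t F = m }

/-- Frankl–Katona: among more than `|Z|` subsets of `Z` there are `r ≥ 1` of them whose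
intersection has exactly `r - 1` elements. -/
theorem frankl_katona {ι α : Type*} [DecidableEq ι] [DecidableEq α] (A : ι → Finset α)
    (Z : Finset α) (B : Finset ι) (hZB : Z.card < B.card) :
    ∃ I ⊆ B, I.Nonempty ∧ (Z.filter (fun z => ∀ x ∈ I, z ∈ A x)).card + 1 = I.card := by
  induction hn : Z.card using Nat.strong_induction_on generalizing Z B with
  | _ n ih =>
  subst hn
  by_contra hcon
  push Not at hcon
  have hne : ∀ x ∈ B, (Z.filter (fun z => z ∈ A x)).Nonempty := by
    intro x hx
    rw [← Finset.card_pos, Nat.pos_iff_ne_zero]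
    intro h0
    have := hcon {x} (by simpa using hx) (by simp)
    simp [h0] at this
  have key : ∀ x ∈ B, ∀ z ∈ Z, z ∈ A x →
      (B.filter (fun y => z ∈ A y)).card ≤ (Z.filter (fun z => z ∈ A x)).card := by
    intro x hx z hz hzx
    by_contra! hlt
    have hzmem : z ∈ Z.filter (fun z => z ∈ A x) := by simp [hz, hzx]
    have hxmem : x ∈ B.filter (fun y => z ∈ A y) := by simp [hx, hzx]
    have c1 := Finset.card_erase_of_mem hzmem
    have c2 := Finset.card_erase_of_mem hxmem
    have p1 := Finset.card_pos.2 ⟨z, hzmem⟩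
    have p3 := Finset.card_filter_le Z (fun z => z ∈ A x)
    obtain ⟨I, hI, hIne, hIc⟩ := ih ((Z.filter (fun z => z ∈ A x)).erase z).card (by omega)
      ((Z.filter (fun z => z ∈ A x)).erase z) ((B.filter (fun y => z ∈ A y)).erase x)
      (by omega) rfl
    have hxI : x ∉ I := fun h => by simpa using hI h
    have hzI : ∀ y ∈ I, z ∈ A y := fun y hy => by
      have := hI hy
      simp at this
      exact this.2.2
    apply hcon (insert x I)
    · intro y hy
      rcases Finset.mem_insert.1 hy with rfl | hy
      · exact hx
      · have := hI hy
        simp at this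
        exact this.2.1
    · simp
    · have e : (Z.filter (fun w => ∀ y ∈ insert x I, w ∈ A y))
          = insert z (((Z.filter (fun z => z ∈ A x)).erase z).filter
              (fun w => ∀ y ∈ I, w ∈ A y)) := by
        ext w
        simp only [Finset.mem_filter, Finset.mem_insert, Finset.mem_erase, forall_eq_or_imp]
        constructor
        · rintro ⟨h1, h2, h3⟩
          by_cases hw : w = z
          · exact Or.inl hw
          · exact Or.inr ⟨⟨hw, h1, h2⟩, h3⟩
        · rintro (rfl | ⟨⟨-, h1, h2⟩, h3⟩)
          · exact ⟨hz, hzx, hzI⟩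
          · exact ⟨h1, h2, h3⟩
      rw [e, Finset.card_insert_of_notMem (by simp), hIc, Finset.card_insert_of_notMem hxI]
  have h1 : (B.card : ℚ) = ∑ x ∈ B, ∑ z ∈ Z, if z ∈ A x then
      (1 / ((Z.filter (fun z => z ∈ A x)).card : ℚ)) else 0 := by
    rw [Finset.card_eq_sum_ones, Nat.cast_sum]
    apply Finset.sum_congr rfl
    intro x hx
    have := Finset.card_pos.2 (hne x hx)
    rw [← Finset.sum_filter, Finset.sum_const, nsmul_eq_mul]
    field_simp
    simp
  have h2 : (∑ x ∈ B, ∑ z ∈ Z, if z ∈ A x then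
      (1 / ((Z.filter (fun z => z ∈ A x)).card : ℚ)) else 0) ≤ Z.card := by
    rw [Finset.sum_comm, Finset.card_eq_sum_ones, Nat.cast_sum]
    apply Finset.sum_le_sum
    intro z hz
    rw [← Finset.sum_filter]
    calc _ ≤ ∑ x ∈ B.filter (fun x => z ∈ A x), 1 / ((B.filter (fun y => z ∈ A y)).card : ℚ) := by
          apply Finset.sum_le_sum
          intro x hx
          have hx' := Finset.mem_filter.1 hx
          have h3 := Finset.card_pos.2 ⟨x, hx⟩
          apply one_div_le_one_div_of_le
          · exact_mod_cast h3
          · exact_mod_cast key x hx'.1 z hz hx'.2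
      _ ≤ _ := by
          rw [Finset.sum_const, nsmul_eq_mul]
          push_cast
          rcases Nat.eq_zero_or_pos (B.filter (fun y => z ∈ A y)).card with h | h
          · simp [h]
          · field_simp
            exact le_refl _
  rw [← h1] at h2
  have : B.card ≤ Z.card := by exact_mod_cast h2
  omega

/-- An intersection-closed family on a `k`-set without `t`-sets, all of whose spanning sets have
at least `k - t - 1 ≥ t + 2` elements, contains all supersets of some `(t+1)`-set. -/
theorem exists_kernel {ι : Type*} [Fintype ι] [DecidableEq ι] (t : ℕ)
    (C : Finset ι → Prop) (hinter : ∀ I J, C I → C J → C (I ∩ J)) (huniv : C Finset.univ)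
    (hk : 2 * t + 3 ≤ Fintype.card ι) (ht : ∀ I, C I → I.card ≠ t)
    (hcov : ∀ S : Finset ι, S.card + t + 2 ≤ Fintype.card ι → ∃ K, C K ∧ S ⊆ K ∧ K ≠ Finset.univ) :
    ∃ T : Finset ι, T.card = t + 1 ∧ ∀ I, T ⊆ I → C I := by
  classical
  have hinf : ∀ (L : Finset ι), C L → ∀ (K : ι → Finset ι) (P : Finset ι), (∀ x ∈ P, C (K x)) →
      C (L.filter (fun z => ∀ x ∈ P, z ∈ K x)) := by
    intro L hL K P
    induction P using Finset.induction_on with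
    | empty => intro _; simpa using hL
    | insert a P ha ih =>
      intro h
      have h1 := hinter _ _ (h a (by simp)) (ih (fun x hx => h x (by simp [hx])))
      convert h1 using 1
      ext z
      simp only [Finset.mem_filter, Finset.mem_insert, forall_eq_or_imp, Finset.mem_inter]
      tauto
  obtain ⟨B, hB⟩ := (Set.toFinite {S : Finset ι | ∀ K, C K → S ⊆ K → K = Finset.univ}).exists_minimal
    ⟨Finset.univ, fun K _ h => Finset.univ_subset_iff.1 h⟩
  have hspan : ∀ K, C K → B ⊆ K → K = Finset.univ := hB.1
  have hK : ∀ x : ι, ∃ K, C K ∧ (x ∈ B → B.erase x ⊆ K ∧ x ∉ K) := by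
    intro x
    by_cases hx : x ∈ B
    · have : ¬ (∀ K, C K → B.erase x ⊆ K → K = Finset.univ) := by
        intro h
        have := hB.2 h (Finset.erase_subset x B) hx
        simp at this
      push Not at this
      obtain ⟨K, h1, h2, h3⟩ := this
      refine ⟨K, h1, fun _ => ⟨h2, fun hxK => h3 (hspan K h1 ?_)⟩⟩
      intro y hy
      by_cases hyx : y = x
      · exact hyx ▸ hxK
      · exact h2 (Finset.mem_erase.2 ⟨hyx, hy⟩)
    · exact ⟨_, huniv, fun h => absurd h hx⟩
  choose K hKC hKB using hK
  have hBcard : Fintype.card ι ≤ B.card + t + 1 := by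
    by_contra! h
    obtain ⟨L, h1, h2, h3⟩ := hcov B (by omega)
    exact h3 (hspan L h1 h2)
  have hBc : (Finset.univ \ B).card + B.card = Fintype.card ι := by
    rw [Finset.card_sdiff_add_card_eq_card (Finset.subset_univ B), Finset.card_univ]
  by_cases hall : ∀ x ∈ B, ∀ z, z ∉ B → z ∈ K x
  · have hsup : ∀ I, Finset.univ \ B ⊆ I → C I := by
      intro I hI
      have := hinf _ huniv K (Finset.univ \ I) (fun x _ => hKC x)
      convert this using 1
      have hIB : ∀ x, x ∉ I → x ∈ B := fun x hx => by
        by_contra h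
        exact hx (hI (by simp [h]))
      ext z
      simp only [Finset.mem_filter, Finset.mem_univ, true_and, Finset.mem_sdiff]
      constructor
      · intro hz x hx
        by_cases hzB : z ∈ B
        · exact (hKB x (hIB x hx)).1 (Finset.mem_erase.2 ⟨fun h => hx (h ▸ hz), hzB⟩)
        · exact hall x (hIB x hx) z hzB
      · intro h
        by_contra hz
        exact (hKB z (hIB z hz)).2 (h z hz)
    refine ⟨Finset.univ \ B, ?_, hsup⟩
    by_contra hne
    obtain ⟨I, h1, h2, h3⟩ := Finset.exists_subsuperset_card_eq
      (Finset.subset_univ (Finset.univ \ B)) (n := t) (by omega) (by rw [Finset.card_univ]; omega)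
    exact ht I (hsup I h1) h3
  · exfalso
    push Not at hall
    obtain ⟨x₀, hx₀, z₀, hz₀, hz₀K⟩ := hall
    obtain ⟨P, hP1, hP2, hP3⟩ := Finset.exists_subsuperset_card_eq
      (s := {x₀}) (t := B) (by simpa using hx₀) (n := B.card - t - 1)
      (by simp; omega) (by omega)
    set L := Finset.univ.filter (fun z => ∀ x ∈ P, z ∈ K x) with hL
    have hLC : C L := hinf _ huniv K P (fun x _ => hKC x)
    have hx₀P : x₀ ∈ P := hP1 (by simp)
    have hBP : (B \ P).card = t + 1 := by
      rw [Finset.card_sdiff_of_subset hP2]; omega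
    have hLB : L ∩ B = B \ P := by
      ext z
      simp only [hL, Finset.mem_inter, Finset.mem_filter, Finset.mem_univ, true_and,
        Finset.mem_sdiff]
      constructor
      · rintro ⟨h1, h2⟩
        exact ⟨h2, fun h => (hKB z h2).2 (h1 z h)⟩
      · rintro ⟨h1, h2⟩
        exact ⟨fun x hx => (hKB x (hP2 hx)).1 (Finset.mem_erase.2 ⟨fun h => h2 (h ▸ hx), h1⟩), h1⟩
    have hLZ : (L \ B).card < (B \ P).card := by
      have : L \ B ⊆ (Finset.univ \ B).erase z₀ := by
        intro z hz
        simp only [hL, Finset.mem_sdiff, Finset.mem_filter, Finset.mem_univ, true_and] at hz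
        simp only [Finset.mem_erase, Finset.mem_sdiff, Finset.mem_univ, true_and]
        exact ⟨fun h => hz₀K (h ▸ hz.1 x₀ hx₀P), hz.2⟩
      have h1 := Finset.card_le_card this
      rw [Finset.card_erase_of_mem (by simp [hz₀])] at h1
      omega
    obtain ⟨I, hI, hIne, hIc⟩ := frankl_katona K (L \ B) (B \ P) hLZ
    have hIB : ∀ x ∈ I, x ∈ B := fun x hx => (Finset.mem_sdiff.1 (hI hx)).1
    apply ht _ (hinf L hLC K I (fun x _ => hKC x))
    have e : L.filter (fun z => ∀ x ∈ I, z ∈ K x)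
        = ((L \ B).filter (fun z => ∀ x ∈ I, z ∈ K x)) ∪ ((B \ P) \ I) := by
      rw [← hLB]
      ext z
      simp only [Finset.mem_filter, Finset.mem_union, Finset.mem_sdiff, Finset.mem_inter]
      constructor
      · rintro ⟨h1, h2⟩
        by_cases hzB : z ∈ B
        · exact Or.inr ⟨⟨h1, hzB⟩, fun h => (hKB z hzB).2 (h2 z h)⟩
        · exact Or.inl ⟨⟨h1, hzB⟩, h2⟩
      · rintro (⟨⟨h1, -⟩, h2⟩ | ⟨⟨h1, h2⟩, h3⟩)
        · exact ⟨h1, h2⟩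
        · exact ⟨h1, fun x hx => (hKB x (hIB x hx)).1
            (Finset.mem_erase.2 ⟨fun h => h3 (h ▸ hx), h2⟩)⟩
    rw [e, Finset.card_union_of_disjoint, Finset.card_sdiff_of_subset hI]
    · have h1 := Finset.card_le_card hI
      have h2 : ((L \ B).filter (fun z => ∀ x ∈ I, z ∈ K x)).card + 1 = I.card := by
        convert hIc
      omega
    · rw [Finset.disjoint_left]
      intro z hz hz'
      simp only [Finset.mem_filter, Finset.mem_sdiff] at hz hz'
      exact hz.1.2 hz'.1.1

/-- The `j`-element subsets of members of a set family. -/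
def levelShadow {α : Type*} [DecidableEq α] (j : ℕ) (L : Finset (Finset α)) :
    Finset (Finset α) :=
  L.biUnion (Finset.powersetCard j)

theorem mem_levelShadow {α : Type*} [DecidableEq α] {j : ℕ} {L : Finset (Finset α)}
    {W : Finset α} : W ∈ levelShadow j L ↔ ∃ G ∈ L, W ⊆ G ∧ W.card = j := by
  simp [levelShadow, Finset.mem_powersetCard]

theorem sum_card_filter_mem {α : Type*} [DecidableEq α] (V : Finset α) (L : Finset (Finset α))
    (j : ℕ) (hV : ∀ G ∈ L, G ⊆ V) (hj : ∀ G ∈ L, G.card = j) :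
    ∑ x ∈ V, (L.filter (fun G => x ∈ G)).card = j * L.card := by
  simp_rw [Finset.card_filter]
  rw [Finset.sum_comm]
  have : ∀ G ∈ L, (∑ x ∈ V, if x ∈ G then 1 else 0) = j := by
    intro G hG
    rw [← Finset.card_filter, Finset.filter_mem_eq_inter, Finset.inter_eq_right.2 (hV G hG), hj G hG]
  rw [Finset.sum_congr rfl this]
  simp [mul_comm]

/-- A local form of the Kruskal–Katona inequality. -/
theorem card_le_card_levelShadow_succ {α : Type*} [DecidableEq α] (m : ℕ) (y : ℝ)
    (hy : 0 ≤ y) (L : Finset (Finset α)) (hL : ∀ G ∈ L, G.card = m + 2)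
    (hsh : ((m + 1).factorial : ℝ) * (levelShadow (m + 1) L).card ≤ y ^ (m + 1)) :
    ((m + 2).factorial : ℝ) * L.card ≤ y * ((m + 1).factorial * (levelShadow (m + 1) L).card) := by
  induction m using Nat.strong_induction_on generalizing L with
  | _ m ih =>
  set V := L.biUnion id with hV
  have hGV : ∀ G ∈ L, G ⊆ V := fun G hG => Finset.subset_biUnion_of_mem id hG
  set link : α → Finset (Finset α) := fun x => (L.filter (fun G => x ∈ G)).image (·.erase x)
    with hlink
  have hlc : ∀ x, (link x).card = (L.filter (fun G => x ∈ G)).card := by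
    intro x
    apply Finset.card_image_of_injOn
    intro G hG H hH h
    simp only [Finset.coe_filter, Set.mem_ofPred_eq] at hG hH
    rw [← Finset.insert_erase hG.2, ← Finset.insert_erase hH.2]
    exact congrArg _ h
  have hlmem : ∀ x, ∀ W ∈ link x, x ∉ W ∧ insert x W ∈ L ∧ W.card = m + 1 := by
    intro x W hW
    simp only [hlink, Finset.mem_image, Finset.mem_filter] at hW
    obtain ⟨G, ⟨hG, hx⟩, rfl⟩ := hW
    refine ⟨by simp, by rwa [Finset.insert_erase hx], ?_⟩
    rw [Finset.card_erase_of_mem hx, hL G hG]; rfl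
  have hls : ∀ x, (link x).card ≤ (levelShadow (m + 1) L).card := by
    intro x
    apply Finset.card_le_card
    intro W hW
    obtain ⟨h1, h2, h3⟩ := hlmem x W hW
    exact mem_levelShadow.2 ⟨_, h2, Finset.subset_insert _ _, h3⟩
  have hsl : ∀ x, (levelShadow m (link x)).card
      ≤ ((levelShadow (m + 1) L).filter (fun G => x ∈ G)).card := by
    intro x
    apply Finset.card_le_card_of_injOn (fun W => insert x W)
    · intro W hW
      obtain ⟨H, hH, hWH, hWc⟩ := mem_levelShadow.1 (Finset.mem_coe.1 hW)
      obtain ⟨h1, h2, h3⟩ := hlmem x H hH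
      simp only [Finset.coe_filter, Set.mem_ofPred_eq, Finset.mem_insert_self, and_true]
      refine mem_levelShadow.2 ⟨_, h2, Finset.insert_subset_insert _ hWH, ?_⟩
      rw [Finset.card_insert_of_notMem (fun h => h1 (hWH h)), hWc]
    · intro W hW W' hW' h
      have hx : ∀ W ∈ levelShadow m (link x), x ∉ W := by
        intro W hW hx
        obtain ⟨H, hH, hWH, hWc⟩ := mem_levelShadow.1 hW
        exact (hlmem x H hH).1 (hWH hx)
      rw [← Finset.erase_insert (hx W hW), ← Finset.erase_insert (hx W' hW')]
      exact congrArg (Finset.erase · x) h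
  have hstep : ∀ x ∈ V, ((m + 1).factorial : ℝ) * (link x).card
      ≤ y * (m.factorial * (levelShadow m (link x)).card) := by
    intro x hx
    have hle : ((m + 1).factorial : ℝ) * (link x).card ≤ y ^ (m + 1) :=
      le_trans (mul_le_mul_of_nonneg_left (by exact_mod_cast hls x) (by positivity)) hsh
    by_cases hm : m = 0
    · subst hm
      have h1 : levelShadow 0 (link x) = {∅} := by
        ext W
        rw [mem_levelShadow]
        simp only [Finset.card_eq_zero, Finset.mem_singleton]
        constructor
        · rintro ⟨_, _, _, h⟩; exact h
        · rintro rfl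
          simp only [hV, Finset.mem_biUnion, id] at hx
          obtain ⟨G, hG, hxG⟩ := hx
          exact ⟨G.erase x, Finset.mem_image_of_mem _ (by simp [hG, hxG]), by simp, rfl⟩
      rw [h1]
      simpa using hle
    · obtain ⟨m', rfl⟩ := Nat.exists_eq_succ_of_ne_zero hm
      rcases le_or_gt (((m' + 1).factorial : ℝ) * (levelShadow (m' + 1) (link x)).card)
        (y ^ (m' + 1)) with h | h
      · exact ih m' (by omega) (link x) (fun G hG => (hlmem x G hG).2.2) h
      · refine hle.trans ?_
        rw [pow_succ']
        exact mul_le_mul_of_nonneg_left h.le hy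
  have hs1 : ∑ x ∈ V, (link x).card = (m + 2) * L.card := by
    simp_rw [hlc]
    exact sum_card_filter_mem V L _ hGV hL
  have hs2 : ∑ x ∈ V, (levelShadow m (link x)).card ≤ (m + 1) * (levelShadow (m + 1) L).card := by
    rw [← sum_card_filter_mem V (levelShadow (m + 1) L) (m + 1)]
    · exact Finset.sum_le_sum fun x _ => hsl x
    · intro W hW
      obtain ⟨G, hG, h, -⟩ := mem_levelShadow.1 hW
      exact h.trans (hGV G hG)
    · intro W hW
      obtain ⟨G, hG, -, h⟩ := mem_levelShadow.1 hW
      exact h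
  have hs3 := Finset.sum_le_sum hstep
  rw [← Finset.mul_sum, ← Finset.mul_sum, ← Finset.mul_sum, ← Nat.cast_sum, ← Nat.cast_sum,
    hs1] at hs3
  have hs4 : ((∑ x ∈ V, (levelShadow m (link x)).card : ℕ) : ℝ)
      ≤ ((m + 1) * (levelShadow (m + 1) L).card : ℕ) := by exact_mod_cast hs2
  calc ((m + 2).factorial : ℝ) * L.card = (m + 1).factorial * (((m + 2) * L.card : ℕ) : ℝ) := by
        rw [Nat.factorial_succ (m + 1)]; push_cast; ring
    _ ≤ _ := hs3
    _ ≤ y * (m.factorial * ((m + 1) * (levelShadow (m + 1) L).card : ℕ)) := by gcongr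
    _ = _ := by rw [Nat.factorial_succ m]; push_cast; ring

theorem levelShadow_mono {α : Type*} [DecidableEq α] (j : ℕ) {L M : Finset (Finset α)}
    (h : L ⊆ M) : levelShadow j L ⊆ levelShadow j M :=
  Finset.biUnion_subset_biUnion_of_subset_left _ h

/-- Iterated form of `card_le_card_levelShadow_succ`. -/
theorem card_le_card_levelShadow {α : Type*} [DecidableEq α] (t : ℕ) (ht : 1 ≤ t) (y : ℝ)
    (hy : 0 ≤ y) (s : ℕ) (hts : t ≤ s) (L : Finset (Finset α)) (hL : ∀ G ∈ L, G.card = s)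
    (hsh : (t.factorial : ℝ) * (levelShadow t L).card ≤ y ^ t) :
    (s.factorial : ℝ) * L.card ≤ y ^ (s - t) * (t.factorial * (levelShadow t L).card) := by
  induction s, hts using Nat.le_induction generalizing L with
  | base =>
    have : L ⊆ levelShadow t L := fun G hG => mem_levelShadow.2 ⟨G, hG, subset_rfl, hL G hG⟩
    have := Finset.card_le_card this
    simp only [tsub_self, pow_zero, one_mul]
    gcongr
  | succ s hts ih =>
    obtain ⟨m, rfl⟩ : ∃ m, s = m + 1 := ⟨s - 1, by omega⟩
    have hsub : levelShadow t (levelShadow (m + 1) L) ⊆ levelShadow t L := by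
      intro W hW
      obtain ⟨H, hH, h1, h2⟩ := mem_levelShadow.1 hW
      obtain ⟨G, hG, h3, h4⟩ := mem_levelShadow.1 hH
      exact mem_levelShadow.2 ⟨G, hG, h1.trans h3, h2⟩
    have hc : ((levelShadow t (levelShadow (m + 1) L)).card : ℝ) ≤ (levelShadow t L).card := by
      exact_mod_cast Finset.card_le_card hsub
    have h1 := ih (levelShadow (m + 1) L) (fun W hW => by
      obtain ⟨G, hG, h3, h4⟩ := mem_levelShadow.1 hW
      exact h4) (le_trans (by gcongr) hsh)
    have h2 : ((m + 1).factorial : ℝ) * (levelShadow (m + 1) L).card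
        ≤ y ^ (m + 1 - t) * (t.factorial * (levelShadow t L).card) := by
      refine h1.trans ?_
      gcongr
    have h3 := card_le_card_levelShadow_succ m y hy L hL (by
      refine h2.trans ?_
      calc _ ≤ y ^ (m + 1 - t) * y ^ t := by gcongr
        _ = _ := by rw [← pow_add]; congr 1; omega)
    refine h3.trans ?_
    rw [show m + 1 + 1 - t = (m + 1 - t) + 1 by omega, pow_succ', mul_assoc]
    gcongr

/-- A family of `s`-sets of density at most `ξ ^ s` is small compared with its `t`-shadow. -/
theorem card_le_mul_card_levelShadow {α : Type*} [DecidableEq α] (s t n : ℕ) (ht : 1 ≤ t)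
    (hts : t < s) (ξ : ℝ) (hξ : 0 < ξ) (hξ1 : ξ ≤ 1) (L : Finset (Finset α))
    (hL : ∀ G ∈ L, G.card = s) (hc : (L.card : ℝ) ≤ ξ ^ s * n ^ s) :
    (L.card : ℝ) ≤ ξ * t.factorial * n ^ (s - t) * (levelShadow t L).card := by
  have hpow : (ξ * n) ^ (s - t) ≤ ξ * (n : ℝ) ^ (s - t) := by
    rw [mul_pow]
    gcongr
    exact pow_le_of_le_one hξ.le hξ1 (by omega)
  have key : (L.card : ℝ) ≤ (ξ * n) ^ (s - t) * (t.factorial * (levelShadow t L).card) := by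
    rcases le_or_gt ((t.factorial : ℝ) * (levelShadow t L).card) ((ξ * n) ^ t) with h | h
    · have h1 := card_le_card_levelShadow t ht (ξ * n) (by positivity) s hts.le L hL h
      refine le_trans ?_ h1
      have : (1 : ℝ) ≤ s.factorial := by exact_mod_cast Nat.factorial_pos s
      nlinarith [(Nat.cast_nonneg L.card : (0 : ℝ) ≤ L.card)]
    · refine hc.trans ?_
      rw [← mul_pow, show (ξ * (n : ℝ)) ^ s = (ξ * n) ^ (s - t) * (ξ * n) ^ t by
        rw [← pow_add]; congr 1; omega]
      gcongr
  refine key.trans ?_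
  calc _ ≤ (ξ * (n : ℝ) ^ (s - t)) * (t.factorial * (levelShadow t L).card) := by gcongr
    _ = _ := by ring

/-- On the family `R`, the `i`-th coordinate is a function of the coordinates in `A`. -/
def IsDetermined {β ι γ : Type*} (X : β → ι → γ) (R : Finset β) (A : Finset ι) (i : ι) : Prop :=
  ∀ F ∈ R, ∀ G ∈ R, (∀ a ∈ A, X F a = X G a) → X F i = X G i

theorem IsDetermined.mono {β ι γ : Type*} {X : β → ι → γ} {R R' : Finset β} {A A' : Finset ι}
    {i : ι} (h : IsDetermined X R A i) (hR : R' ⊆ R) (hA : A ⊆ A') : IsDetermined X R' A' i :=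
  fun F hF G hG hFG => h F (hR hF) G (hR hG) fun a ha => hFG a (hA ha)

/-- Every family has a large subfamily in which each coordinate is either determined by a given
set of coordinates or far from determined by it. -/
theorem exists_homogeneous {β ι γ : Type*} [Fintype ι] [DecidableEq ι] (X : β → ι → γ)
    (θ : ℝ) (hθ : 0 < θ) (hθ1 : θ ≤ 1) (R : Finset β) :
    ∃ S ⊆ R, θ ^ (Fintype.card (Finset ι × ι)) * R.card ≤ S.card ∧
      ∀ A i, IsDetermined X S A i ∨ ∀ S' ⊆ S, IsDetermined X S' A i → (S'.card : ℝ) ≤ θ * S.card := by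
  classical
  suffices H : ∀ m : ℕ, ∀ R : Finset β,
      (Finset.univ.filter (fun p : Finset ι × ι => ¬ IsDetermined X R p.1 p.2)).card ≤ m →
      ∃ S ⊆ R, θ ^ m * R.card ≤ S.card ∧ ∀ A i, IsDetermined X S A i ∨
        ∀ S' ⊆ S, IsDetermined X S' A i → (S'.card : ℝ) ≤ θ * S.card from
    H _ R (Finset.card_le_univ _)
  intro m
  induction m with
  | zero =>
    intro R hR
    refine ⟨R, subset_rfl, by simp, fun A i => Or.inl ?_⟩
    by_contra h
    have : (A, i) ∈ Finset.univ.filter (fun p : Finset ι × ι => ¬ IsDetermined X R p.1 p.2) := by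
      simpa using h
    rw [Finset.card_eq_zero.1 (Nat.le_zero.1 hR)] at this
    simp at this
  | succ m ih =>
    intro R hR
    by_cases hfin : ∀ A i, IsDetermined X R A i ∨
        ∀ S' ⊆ R, IsDetermined X S' A i → (S'.card : ℝ) ≤ θ * R.card
    · exact ⟨R, subset_rfl, mul_le_of_le_one_left (by positivity) (pow_le_one₀ hθ.le hθ1), hfin⟩
    · push Not at hfin
      obtain ⟨A, i, hnd, R', hR', hd, hc⟩ := hfin
      have hlt : (Finset.univ.filter (fun p : Finset ι × ι => ¬ IsDetermined X R' p.1 p.2)).card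
          < (Finset.univ.filter (fun p : Finset ι × ι => ¬ IsDetermined X R p.1 p.2)).card := by
        apply Finset.card_lt_card
        rw [Finset.ssubset_iff_of_subset]
        · exact ⟨(A, i), by simpa using hnd, by simpa using hd⟩
        · intro p hp
          simp only [Finset.mem_filter, Finset.mem_univ, true_and] at hp ⊢
          exact fun h => hp (h.mono hR' subset_rfl)
      obtain ⟨S, h1, h2, h3⟩ := ih R' (by omega)
      refine ⟨S, h1.trans hR', le_trans ?_ h2, h3⟩
      rw [pow_succ, mul_assoc]
      gcongr

/-- The increasing enumeration of a `k`-element set of natural numbers (and a strictly increasing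
junk value for other sets). -/
def increasingEnum (k : ℕ) (F : Finset ℕ) (i : Fin k) : ℕ :=
  if h : F.card = k then F.orderEmbOfFin h i else i

theorem increasingEnum_strictMono (k : ℕ) (F : Finset ℕ) : StrictMono (increasingEnum k F) := by
  intro i j hij
  unfold increasingEnum
  split_ifs with h
  · exact (F.orderEmbOfFin h).strictMono hij
  · exact hij

theorem image_increasingEnum {k : ℕ} {F : Finset ℕ} (h : F.card = k) :
    Finset.univ.image (increasingEnum k F) = F := by
  have : increasingEnum k F = F.orderEmbOfFin h := by
    funext i
    simp [increasingEnum, h]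
  rw [this]
  exact Finset.image_orderEmbOfFin_univ F h

theorem image_increasingEnum_subset {k : ℕ} {F : Finset ℕ} (h : F.card = k) (A : Finset (Fin k)) :
    A.image (increasingEnum k F) ⊆ F := by
  conv_rhs => rw [← image_increasingEnum h]
  exact Finset.image_subset_image (Finset.subset_univ A)

theorem card_image_increasingEnum (k : ℕ) (F : Finset ℕ) (A : Finset (Fin k)) :
    (A.image (increasingEnum k F)).card = A.card :=
  Finset.card_image_of_injective _ (increasingEnum_strictMono k F).injective

theorem image_increasingEnum_eq_iff {k : ℕ} {F G : Finset ℕ} {A : Finset (Fin k)} :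
    A.image (increasingEnum k F) = A.image (increasingEnum k G) ↔
      ∀ a ∈ A, increasingEnum k F a = increasingEnum k G a := by
  constructor
  · intro h a ha
    have key : ∀ H, A.image (increasingEnum k H) = A.image (increasingEnum k F) →
        (fun j => increasingEnum k H (A.orderEmbOfFin rfl j))
          = (A.image (increasingEnum k F)).orderEmbOfFin (card_image_increasingEnum k F A) := by
      intro H hH
      apply Finset.orderEmbOfFin_unique
      · intro j
        rw [← hH]
        exact Finset.mem_image_of_mem _ (Finset.orderEmbOfFin_mem A rfl j)
      · exact (increasingEnum_strictMono k H).comp (A.orderEmbOfFin rfl).strictMono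
    have := (key F rfl).trans (key G h.symm).symm
    have hr : a ∈ Set.range (A.orderEmbOfFin rfl) := by
      rw [Finset.range_orderEmbOfFin]; exact ha
    obtain ⟨j, rfl⟩ := hr
    exact congrFun this j
  · intro h
    exact Finset.image_congr h

/-- The number of ordered pairs of members of `F` meeting in exactly `t` elements. -/
def orderedPairs (t : ℕ) (F : Finset (Finset ℕ)) : ℕ :=
  ((F ×ˢ F).filter (fun p => (p.1 ∩ p.2).card = t)).card

theorem orderedPairs_eq_sum (t : ℕ) (F : Finset (Finset ℕ)) :
    orderedPairs t F = ∑ A ∈ F, (F.filter (fun B => (A ∩ B).card = t)).card := by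
  unfold orderedPairs
  rw [Finset.card_filter, Finset.sum_product]
  simp_rw [Finset.card_filter]

theorem orderedPairs_mono (t : ℕ) {F G : Finset (Finset ℕ)} (h : F ⊆ G) :
    orderedPairs t F ≤ orderedPairs t G :=
  Finset.card_le_card (Finset.filter_subset_filter _ (Finset.product_subset_product h h))

/-- If no coordinate outside the `t`-set `A` is close to being determined by `A`, then there are
many pairs meeting in exactly `t` elements. -/
theorem sq_card_le_orderedPairs (k t : ℕ) (R : Finset (Finset ℕ)) (hR : ∀ F ∈ R, F.card = k)
    (θ : ℝ) (hθ : 4 * (k : ℝ) ^ 3 * θ ≤ 1) (A : Finset (Fin k)) (hA : A.card = t)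
    (hfree : ∀ i ∉ A, ∀ S ⊆ R, IsDetermined (increasingEnum k) S A i →
      (S.card : ℝ) ≤ θ * R.card) :
    (R.card : ℝ) ^ 2 ≤ 8 * (levelShadow t R).card * orderedPairs t R := by
  classical
  set X := increasingEnum k with hX
  set key : Finset ℕ → Finset ℕ := fun F => A.image (X F) with hkey
  set cl : Finset ℕ → Finset (Finset ℕ) := fun w => R.filter (fun F => key F = w) with hcl
  set Bad : Finset ℕ → Fin k → ℕ → Prop := fun w i v =>
    (cl w).card < 2 * k ^ 2 * ((cl w).filter (fun G => X G i = v)).card with hBad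
  obtain ⟨ψ, hψ⟩ : ∃ ψ : Fin k → Finset ℕ → ℕ, ∀ i w, (∃ v, Bad w i v) → Bad w i (ψ i w) := by
    refine ⟨fun i w => if h : ∃ v, Bad w i v then h.choose else 0, fun i w h => ?_⟩
    simp only [h, dif_pos]
    exact h.choose_spec
  set Bi : Fin k → Finset (Finset ℕ) := fun i => R.filter (fun F => ∃ v, Bad (key F) i v) with hBi
  set Ri : Fin k → Finset (Finset ℕ) := fun i =>
    (Bi i).filter (fun F => X F i = ψ i (key F)) with hRi
  have hBR : ∀ i, (Bi i).card ≤ 2 * k ^ 2 * (Ri i).card := by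
    intro i
    have m1 : ∀ F ∈ Bi i, key F ∈ R.image key := fun F hF =>
      Finset.mem_image_of_mem _ (Finset.filter_subset _ _ hF)
    have m2 : ∀ F ∈ Ri i, key F ∈ R.image key := fun F hF => m1 F (Finset.filter_subset _ _ hF)
    rw [Finset.card_eq_sum_card_fiberwise m1, Finset.card_eq_sum_card_fiberwise m2,
      Finset.mul_sum]
    apply Finset.sum_le_sum
    intro w _
    by_cases hw : ∃ v, Bad w i v
    · have e1 : (Bi i).filter (fun F => key F = w) ⊆ cl w := by
        intro F hF
        simp only [hBi, hcl, Finset.mem_filter] at hF ⊢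
        exact ⟨hF.1.1, hF.2⟩
      have e2 : (cl w).filter (fun G => X G i = ψ i w) ⊆ (Ri i).filter (fun F => key F = w) := by
        intro F hF
        simp only [hRi, hBi, hcl, Finset.mem_filter] at hF ⊢
        obtain ⟨⟨h1, rfl⟩, h2⟩ := hF
        exact ⟨⟨⟨h1, hw⟩, h2⟩, rfl⟩
      calc _ ≤ (cl w).card := Finset.card_le_card e1
        _ ≤ _ := (hψ i w hw).le
        _ ≤ _ := Nat.mul_le_mul_left _ (Finset.card_le_card e2)
    · have : (Bi i).filter (fun F => key F = w) = ∅ := by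
        apply Finset.filter_eq_empty_iff.2
        intro F hF hk
        simp only [hBi, Finset.mem_filter] at hF
        exact hw (hk ▸ hF.2)
      rw [this]; simp
  set Gd : Finset (Finset ℕ) := R.filter (fun F => ∀ i, i ∉ A → ¬ ∃ v, Bad (key F) i v) with hGd
  have hbad : ((R \ Gd).card : ℝ) ≤ R.card / 2 := by
    have h1 : R \ Gd ⊆ (Finset.univ \ A).biUnion Bi := by
      intro F hF
      simp only [hGd, Finset.mem_sdiff, Finset.mem_filter, not_and, not_forall, not_not] at hF
      obtain ⟨i, hi, hb⟩ := hF.2 hF.1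
      simp only [Finset.mem_biUnion, Finset.mem_sdiff, Finset.mem_univ, true_and]
      exact ⟨i, hi, by simp only [hBi, Finset.mem_filter]; exact ⟨hF.1, hb⟩⟩
    have h2 : (R \ Gd).card ≤ ∑ i ∈ Finset.univ \ A, (Bi i).card :=
      (Finset.card_le_card h1).trans Finset.card_biUnion_le
    have h3 : ∀ i ∈ Finset.univ \ A, ((Bi i).card : ℝ) ≤ 2 * k ^ 2 * (θ * R.card) := by
      intro i hi
      have h4 : ((Ri i).card : ℝ) ≤ θ * R.card := by
        apply hfree i (by simpa using hi)
        · exact (Finset.filter_subset _ _).trans (Finset.filter_subset _ _)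
        · intro F hF G hG hFG
          have : key F = key G := image_increasingEnum_eq_iff.2 hFG
          simp only [hRi, Finset.mem_filter] at hF hG
          rw [hF.2, hG.2, this]
      have h5 : ((Bi i).card : ℝ) ≤ 2 * k ^ 2 * (Ri i).card := by exact_mod_cast hBR i
      refine h5.trans ?_
      gcongr
    have h6 : ((R \ Gd).card : ℝ) ≤ ∑ i ∈ Finset.univ \ A, 2 * (k : ℝ) ^ 2 * (θ * R.card) := by
      refine le_trans ?_ (Finset.sum_le_sum h3)
      exact_mod_cast h2
    rw [Finset.sum_const, nsmul_eq_mul] at h6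
    rcases (Finset.univ \ A).eq_empty_or_nonempty with he | ⟨i, hi⟩
    · rw [he] at h6
      simp only [Finset.card_empty, CharP.cast_eq_zero, zero_mul] at h6
      exact h6.trans (by positivity)
    have hθ0 : 0 ≤ θ * R.card := by
      refine le_trans ?_ (hfree i (by simpa using hi) ∅ (by simp) (by intro F hF; simp at hF))
      simp
    have h7 : ((Finset.univ \ A).card : ℝ) ≤ k := by
      have := Finset.card_le_univ (Finset.univ \ A)
      rw [Fintype.card_fin] at this
      exact_mod_cast this
    calc ((R \ Gd).card : ℝ) ≤ _ := h6
      _ ≤ k * (2 * (k : ℝ) ^ 2 * (θ * R.card)) := by gcongr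
      _ = (4 * (k : ℝ) ^ 3 * θ) * (R.card / 2) := by ring
      _ ≤ 1 * (R.card / 2) := by gcongr
      _ = _ := by ring
  have hGdR : Gd ⊆ R := Finset.filter_subset _ _
  have hgood : (R.card : ℝ) / 2 ≤ Gd.card := by
    have : ((R \ Gd).card : ℝ) + Gd.card = R.card := by
      exact_mod_cast Finset.card_sdiff_add_card_eq_card hGdR
    linarith
  set g : Finset ℕ → ℕ := fun w => (Gd.filter (fun F => key F = w)).card with hg
  have hdeg : ∀ F ∈ Gd, g (key F) ≤ 2 * (R.filter (fun G => (F ∩ G).card = t)).card := by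
    intro F hF
    have hF' := Finset.mem_filter.1 hF
    have h1 : g (key F) ≤ (cl (key F)).card :=
      Finset.card_le_card (Finset.filter_subset_filter _ hGdR)
    set E := (Finset.univ \ A).biUnion (fun i => Finset.univ.biUnion fun j =>
      (cl (key F)).filter (fun G => X G i = X F j)) with hE
    have h2 : cl (key F) ⊆ (R.filter (fun G => (F ∩ G).card = t)) ∪ E := by
      intro G hG
      have hG' := Finset.mem_filter.1 hG
      by_cases hGE : G ∈ E
      · exact Finset.mem_union_right _ hGE
      · apply Finset.mem_union_left
        rw [Finset.mem_filter]
        refine ⟨hG'.1, ?_⟩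
        have : F ∩ G = key F := by
          apply Finset.Subset.antisymm
          · intro x hx
            rw [Finset.mem_inter] at hx
            obtain ⟨hxF, hxG⟩ := hx
            rw [← image_increasingEnum (hR F hF'.1)] at hxF
            rw [← image_increasingEnum (hR G hG'.1)] at hxG
            obtain ⟨j, -, hj⟩ := Finset.mem_image.1 hxF
            obtain ⟨i, -, hi⟩ := Finset.mem_image.1 hxG
            by_cases hiA : i ∈ A
            · rw [← hG'.2]
              exact Finset.mem_image.2 ⟨i, hiA, hi⟩
            · exfalso
              apply hGE
              simp only [hE, Finset.mem_biUnion, Finset.mem_sdiff, Finset.mem_univ, true_and]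
              exact ⟨i, hiA, j, Finset.mem_filter.2 ⟨hG, hi.trans hj.symm⟩⟩
          · apply Finset.subset_inter
            · exact image_increasingEnum_subset (hR F hF'.1) A
            · rw [← hG'.2]
              exact image_increasingEnum_subset (hR G hG'.1) A
        rw [this, ← hA]
        exact card_image_increasingEnum k F A
    have h3 : 2 * E.card ≤ (cl (key F)).card := by
      have h4 : ∀ i ∈ Finset.univ \ A, ∀ j : Fin k,
          2 * k ^ 2 * ((cl (key F)).filter (fun G => X G i = X F j)).card
            ≤ (cl (key F)).card := by
        intro i hi j
        have := hF'.2 i (by simpa using hi)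
        push Not at this
        exact not_lt.1 (this (X F j))
      have h5 : E.card ≤ ∑ i ∈ Finset.univ \ A, ∑ j : Fin k,
          ((cl (key F)).filter (fun G => X G i = X F j)).card :=
        Finset.card_biUnion_le.trans (Finset.sum_le_sum fun i _ => Finset.card_biUnion_le)
      have h6 : (2 * k ^ 2) * E.card ≤ k ^ 2 * (cl (key F)).card := by
        calc _ ≤ _ := Nat.mul_le_mul_left _ h5
          _ ≤ ∑ i ∈ Finset.univ \ A, ∑ j : Fin k, (cl (key F)).card := by
            rw [Finset.mul_sum]
            apply Finset.sum_le_sum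
            intro i hi
            rw [Finset.mul_sum]
            exact Finset.sum_le_sum fun j _ => h4 i hi j
          _ = (Finset.univ \ A).card * (k * (cl (key F)).card) := by simp
          _ ≤ k * (k * (cl (key F)).card) := by
            apply Nat.mul_le_mul_right
            simpa using Finset.card_le_univ (Finset.univ \ A)
          _ = _ := by ring
      rcases Nat.eq_zero_or_pos k with hk | hk
      · subst hk
        have : E = ∅ := by
          rw [hE]
          apply Finset.eq_empty_of_forall_notMem
          intro G hG
          simp only [Finset.mem_biUnion] at hG
          obtain ⟨i, _⟩ := hG
          exact i.elim0
        simp [this]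
      · have hk2 : 0 < k ^ 2 := by positivity
        apply Nat.le_of_mul_le_mul_left _ hk2
        calc _ = (2 * k ^ 2) * E.card := by ring
          _ ≤ _ := h6
    have h7 := (Finset.card_le_card h2).trans (Finset.card_union_le _ _)
    omega
  have hsum : ∑ w ∈ Gd.image key, g w ^ 2 ≤ 2 * orderedPairs t R := by
    rw [orderedPairs_eq_sum]
    calc ∑ w ∈ Gd.image key, g w ^ 2 = ∑ w ∈ Gd.image key, ∑ F ∈ Gd with key F = w, g (key F) := by
          apply Finset.sum_congr rfl
          intro w _
          rw [Finset.sum_congr rfl (g := fun _ => g w)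
            (fun F hF => by rw [(Finset.mem_filter.1 hF).2])]
          rw [Finset.sum_const, smul_eq_mul, sq]
      _ = ∑ F ∈ Gd, g (key F) :=
          Finset.sum_fiberwise_of_maps_to (fun F hF => Finset.mem_image_of_mem _ hF) _
      _ ≤ ∑ F ∈ Gd, 2 * (R.filter (fun G => (F ∩ G).card = t)).card := Finset.sum_le_sum hdeg
      _ ≤ ∑ F ∈ R, 2 * (R.filter (fun G => (F ∩ G).card = t)).card :=
          Finset.sum_le_sum_of_subset hGdR
      _ = _ := by rw [Finset.mul_sum]
  have hcs : (Gd.card) ^ 2 ≤ (levelShadow t R).card * (2 * orderedPairs t R) := by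
    calc (Gd.card) ^ 2 = (∑ w ∈ Gd.image key, g w) ^ 2 := by
          rw [← Finset.card_eq_sum_card_fiberwise (fun F hF => Finset.mem_image_of_mem _ hF)]
      _ ≤ (Gd.image key).card * ∑ w ∈ Gd.image key, g w ^ 2 := sq_sum_le_card_mul_sum_sq
      _ ≤ _ := by
          apply Nat.mul_le_mul _ hsum
          apply Finset.card_le_card
          intro w hw
          obtain ⟨F, hF, rfl⟩ := Finset.mem_image.1 hw
          refine mem_levelShadow.2 ⟨F, hGdR hF,
            image_increasingEnum_subset (hR F (hGdR hF)) A, ?_⟩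
          rw [← hA]
          exact card_image_increasingEnum k F A
  have hcs' : (Gd.card : ℝ) ^ 2 ≤ (levelShadow t R).card * (2 * orderedPairs t R) := by
    exact_mod_cast hcs
  have : ((R.card : ℝ) / 2) ^ 2 ≤ (Gd.card : ℝ) ^ 2 := by gcongr
  nlinarith

theorem card_filter_subset_le {n k : ℕ} (U : Finset ℕ) {F : Finset (Finset ℕ)}
    (hF : F ⊆ (Finset.Icc 1 n).powersetCard k) :
    (F.filter (fun G => U ⊆ G)).card ≤ n ^ (k - U.card) := by
  have h1 : (F.filter (fun G => U ⊆ G)).card ≤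
      ((Finset.Icc 1 n).powersetCard (k - U.card)).card := by
    apply Finset.card_le_card_of_injOn (fun G => G \ U)
    · intro G hG
      have hG' := Finset.mem_filter.1 (Finset.mem_coe.1 hG)
      have h2 := Finset.mem_powersetCard.1 (hF hG'.1)
      rw [Finset.mem_coe, Finset.mem_powersetCard, Finset.card_sdiff_of_subset hG'.2, h2.2]
      exact ⟨Finset.sdiff_subset.trans h2.1, rfl⟩
    · intro G hG H hH h
      have hG' := Finset.mem_filter.1 (Finset.mem_coe.1 hG)
      have hH' := Finset.mem_filter.1 (Finset.mem_coe.1 hH)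
      rw [← Finset.sdiff_union_of_subset hG'.2, ← Finset.sdiff_union_of_subset hH'.2]
      exact congrArg (· ∪ U) h
  refine h1.trans ?_
  rw [Finset.card_powersetCard, Nat.card_Icc, Nat.add_sub_cancel]
  exact Nat.choose_le_pow n _

/-- A set of coordinates which determines no coordinate outside of it. -/
def IsDetClosed {β ι γ : Type*} (X : β → ι → γ) (S : Finset β) (I : Finset ι) : Prop :=
  ∀ i ∉ I, ¬ IsDetermined X S I i

theorem IsDetClosed.inter {β ι γ : Type*} [DecidableEq ι] {X : β → ι → γ} {S : Finset β}
    {I J : Finset ι} (hI : IsDetClosed X S I) (hJ : IsDetClosed X S J) :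
    IsDetClosed X S (I ∩ J) := by
  intro i hi hd
  by_cases h : i ∈ I
  · exact hJ i (fun h' => hi (Finset.mem_inter.2 ⟨h, h'⟩))
      (hd.mono subset_rfl Finset.inter_subset_right)
  · exact hI i h (hd.mono subset_rfl Finset.inter_subset_left)

theorem exists_isDetClosed_iff_isDetermined {β ι γ : Type*} [Fintype ι] (X : β → ι → γ)
    (S : Finset β) (W : Finset ι) :
    ∃ K, IsDetClosed X S K ∧ W ⊆ K ∧ ∀ i, i ∈ K ↔ IsDetermined X S W i := by
  classical
  refine ⟨Finset.univ.filter (fun i => IsDetermined X S W i), ?_, ?_, by simp⟩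
  · intro i hi hd
    apply hi
    simp only [Finset.mem_filter, Finset.mem_univ, true_and]
    intro F hF G hG hFG
    apply hd F hF G hG
    intro a ha
    exact (Finset.mem_filter.1 ha).2 F hF G hG hFG
  · intro i hi
    simp only [Finset.mem_filter, Finset.mem_univ, true_and]
    exact fun F _ G _ h => h i hi

theorem image_increasingEnum_mem_levelShadow {k : ℕ} {S : Finset (Finset ℕ)} {F : Finset ℕ}
    (hF : F ∈ S) (hk : F.card = k) (A : Finset (Fin k)) :
    A.image (increasingEnum k F) ∈ levelShadow A.card S :=
  mem_levelShadow.2 ⟨F, hF, image_increasingEnum_subset hk A, card_image_increasingEnum k F A⟩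

/-- A family all of whose coordinates are determined by those in `B`. -/
theorem card_le_of_forall_isDetermined {n k : ℕ} {S : Finset (Finset ℕ)}
    (hS : S ⊆ (Finset.Icc 1 n).powersetCard k) {A B : Finset (Fin k)} (hAB : A ⊆ B)
    (hd : ∀ i, IsDetermined (increasingEnum k) S B i) :
    S.card ≤ (levelShadow A.card S).card * n ^ (B.card - A.card) := by
  have h1 : S.card ≤ (levelShadow A.card S ×ˢ
      (Finset.Icc 1 n).powersetCard (B.card - A.card)).card := by
    apply Finset.card_le_card_of_injOn
      (fun F => (A.image (increasingEnum k F), (B \ A).image (increasingEnum k F)))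
    · intro F hF
      have hF' := Finset.mem_powersetCard.1 (hS hF)
      rw [Finset.mem_coe, Finset.mem_product]
      refine ⟨image_increasingEnum_mem_levelShadow hF hF'.2 A, ?_⟩
      rw [Finset.mem_powersetCard]
      refine ⟨(image_increasingEnum_subset hF'.2 _).trans hF'.1, ?_⟩
      rw [card_image_increasingEnum, Finset.card_sdiff_of_subset hAB]
    · intro F hF G hG h
      simp only [Prod.mk.injEq] at h
      have e1 := image_increasingEnum_eq_iff.1 h.1
      have e2 := image_increasingEnum_eq_iff.1 h.2
      have e3 : ∀ i, increasingEnum k F i = increasingEnum k G i := by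
        intro i
        apply hd i F hF G hG
        intro a ha
        by_cases haA : a ∈ A
        · exact e1 a haA
        · exact e2 a (Finset.mem_sdiff.2 ⟨ha, haA⟩)
      rw [← image_increasingEnum (Finset.mem_powersetCard.1 (hS hF)).2,
        ← image_increasingEnum (Finset.mem_powersetCard.1 (hS hG)).2]
      exact Finset.image_congr fun i _ => e3 i
  refine h1.trans ?_
  rw [Finset.card_product, Finset.card_powersetCard, Nat.card_Icc, Nat.add_sub_cancel]
  exact Nat.mul_le_mul_left _ (Nat.choose_le_pow n _)

/-- If there is no closed `t`-set, every `t`-set disjoint from a kernel determines it. -/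
theorem isDetermined_of_kernel {β ι γ : Type*} [Fintype ι] [DecidableEq ι] {X : β → ι → γ}
    {S : Finset β} {t : ℕ} (hno : ∀ I, IsDetClosed X S I → I.card ≠ t) {T : Finset ι}
    (hT : T.card = t + 1) (hTC : ∀ I, T ⊆ I → IsDetClosed X S I) {W : Finset ι}
    (hW : W.card = t) {i : ι} (hi : i ∈ T) : IsDetermined X S W i := by
  obtain ⟨I, hI, hWI, hmem⟩ := exists_isDetClosed_iff_isDetermined X S W
  rw [← hmem]
  by_contra hiI
  have h1 : (I ∩ T).card ≤ t := by
    have : I ∩ T ⊂ T := by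
      rw [Finset.ssubset_iff_of_subset Finset.inter_subset_right]
      exact ⟨i, hi, fun h => hiI (Finset.mem_inter.1 h).1⟩
    have := Finset.card_lt_card this
    omega
  obtain ⟨Y, hY1, hY2, hY3⟩ := Finset.exists_subsuperset_card_eq
    (Finset.inter_subset_left : I ∩ T ⊆ I) h1 (hW ▸ Finset.card_le_card hWI)
  apply hno Y _ hY3
  have : I ∩ (T ∪ Y) = Y := by
    ext x
    simp only [Finset.mem_inter, Finset.mem_union]
    constructor
    · rintro ⟨h2, h3 | h3⟩
      · exact hY1 (Finset.mem_inter.2 ⟨h2, h3⟩)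
      · exact h3
    · intro h
      exact ⟨hY2 h, Or.inr h⟩
  rw [← this]
  exact hI.inter (hTC _ Finset.subset_union_left)

/-- If every `t`-set of coordinates disjoint from `T` determines the coordinates in `T`, then the
shadows of the links of the `T`-traces are essentially disjoint. -/
theorem card_le_of_kernel (k t s n : ℕ) (ht : 1 ≤ t) (hts : t < s) (hk : k = t + 1 + s)
    (ξ : ℝ) (hξ : 0 < ξ) (hξ1 : ξ ≤ 1) (S : Finset (Finset ℕ)) (hS : ∀ F ∈ S, F.card = k)
    (hdeg : ∀ T : Finset ℕ, T.card = t + 1 →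
      ((S.filter (fun G => T ⊆ G)).card : ℝ) ≤ ξ ^ s * n ^ s)
    (T : Finset (Fin k)) (hT : T.card = t + 1)
    (hdet : ∀ W : Finset (Fin k), W.card = t → ∀ i ∈ T, IsDetermined (increasingEnum k) S W i) :
    (S.card : ℝ) ≤ ξ * t.factorial * 2 ^ k * n ^ (s - t) * (levelShadow t S).card := by
  classical
  set X := increasingEnum k with hX
  set fib : Finset ℕ → Finset (Finset ℕ) := fun τ => S.filter (fun F => T.image (X F) = τ) with hfib
  set 𝒯 := S.image (fun F => T.image (X F)) with h𝒯
  set L : Finset ℕ → Finset (Finset ℕ) := fun τ => (fib τ).image (fun F => Tᶜ.image (X F)) with hL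
  have hTc : Tᶜ.card = s := by rw [Finset.card_compl, Fintype.card_fin, hT]; omega
  have hLc : ∀ τ, (L τ).card = (fib τ).card := by
    intro τ
    apply Finset.card_image_of_injOn
    intro F hF G hG h
    have hF' := Finset.mem_filter.1 (Finset.mem_coe.1 hF)
    have hG' := Finset.mem_filter.1 (Finset.mem_coe.1 hG)
    rw [← image_increasingEnum (hS F hF'.1), ← image_increasingEnum (hS G hG'.1),
      ← Finset.union_compl T, Finset.image_union, Finset.image_union]
    exact congrArg₂ _ (hF'.2.trans hG'.2.symm) h
  have hLsmall : ∀ τ ∈ 𝒯, ((L τ).card : ℝ)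
      ≤ ξ * t.factorial * n ^ (s - t) * (levelShadow t (L τ)).card := by
    intro τ hτ
    apply card_le_mul_card_levelShadow s t n ht hts ξ hξ hξ1
    · intro G hG
      obtain ⟨F, hF, rfl⟩ := Finset.mem_image.1 hG
      rw [card_image_increasingEnum, hTc]
    · rw [hLc]
      obtain ⟨F, hF, rfl⟩ := Finset.mem_image.1 hτ
      refine le_trans ?_ (hdeg (T.image (X F)) (by rw [card_image_increasingEnum, hT]))
      have : fib (T.image (X F)) ⊆ S.filter (fun G => T.image (X F) ⊆ G) := by
        intro G hG
        have hG' := Finset.mem_filter.1 hG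
        rw [Finset.mem_filter]
        refine ⟨hG'.1, ?_⟩
        rw [← hG'.2]
        exact image_increasingEnum_subset (hS G hG'.1) T
      exact_mod_cast Finset.card_le_card this
  have hsh : ∀ τ, (levelShadow t (L τ)).card
      ≤ ∑ W ∈ Finset.univ.powersetCard t, ((fib τ).image (fun F => W.image (X F))).card := by
    intro τ
    refine le_trans (Finset.card_le_card ?_) Finset.card_biUnion_le
    intro V hV
    obtain ⟨G, hG, hVG, hVc⟩ := mem_levelShadow.1 hV
    obtain ⟨F, hF, rfl⟩ := Finset.mem_image.1 hG
    have e : (Finset.univ.filter (fun i => X F i ∈ V)).image (X F) = V := by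
      ext x
      simp only [Finset.mem_image, Finset.mem_filter, Finset.mem_univ, true_and]
      constructor
      · rintro ⟨i, hi, rfl⟩; exact hi
      · intro hx
        obtain ⟨i, -, hi⟩ := Finset.mem_image.1 (hVG hx)
        exact ⟨i, hi ▸ hx, hi⟩
    rw [Finset.mem_biUnion]
    refine ⟨Finset.univ.filter (fun i => X F i ∈ V), ?_, ?_⟩
    · rw [Finset.mem_powersetCard]
      refine ⟨Finset.subset_univ _, ?_⟩
      rw [← hVc]
      conv_rhs => rw [← e]
      exact (card_image_increasingEnum k F _).symm
    · exact Finset.mem_image.2 ⟨F, hF, e⟩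
  have hdisj : ∀ W ∈ (Finset.univ : Finset (Fin k)).powersetCard t,
      ∑ τ ∈ 𝒯, ((fib τ).image (fun F => W.image (X F))).card ≤ (levelShadow t S).card := by
    intro W hW
    have hW' := (Finset.mem_powersetCard.1 hW).2
    rw [← Finset.card_biUnion]
    · apply Finset.card_le_card
      intro V hV
      obtain ⟨τ, -, hV⟩ := Finset.mem_biUnion.1 hV
      obtain ⟨F, hF, rfl⟩ := Finset.mem_image.1 hV
      have hF' := (Finset.mem_filter.1 hF).1
      have := image_increasingEnum_mem_levelShadow hF' (hS F hF') W
      rwa [hW'] at this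
    · intro τ _ τ' _ hne
      rw [Function.onFun, Finset.disjoint_left]
      intro V hV hV'
      obtain ⟨F, hF, rfl⟩ := Finset.mem_image.1 hV
      obtain ⟨G, hG, hGF⟩ := Finset.mem_image.1 hV'
      have hF' := Finset.mem_filter.1 hF
      have hG' := Finset.mem_filter.1 hG
      apply hne
      rw [← hF'.2, ← hG'.2]
      exact (image_increasingEnum_eq_iff.2 fun i hi =>
        hdet W hW' i hi G hG'.1 F hF'.1 (image_increasingEnum_eq_iff.1 hGF)).symm
  have htot : ∑ τ ∈ 𝒯, (levelShadow t (L τ)).card ≤ 2 ^ k * (levelShadow t S).card := by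
    calc _ ≤ ∑ τ ∈ 𝒯, ∑ W ∈ Finset.univ.powersetCard t,
            ((fib τ).image (fun F => W.image (X F))).card := Finset.sum_le_sum fun τ _ => hsh τ
      _ = ∑ W ∈ Finset.univ.powersetCard t, ∑ τ ∈ 𝒯,
            ((fib τ).image (fun F => W.image (X F))).card := Finset.sum_comm
      _ ≤ ∑ W ∈ (Finset.univ : Finset (Fin k)).powersetCard t, (levelShadow t S).card :=
          Finset.sum_le_sum hdisj
      _ = k.choose t * (levelShadow t S).card := by simp
      _ ≤ _ := Nat.mul_le_mul_right _ (Nat.choose_le_two_pow k t)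
  have hcard : S.card = ∑ τ ∈ 𝒯, (L τ).card := by
    rw [Finset.card_eq_sum_card_fiberwise (f := fun F => T.image (X F)) (t := 𝒯)
      (fun F hF => Finset.mem_image_of_mem _ hF)]
    exact Finset.sum_congr rfl fun τ _ => (hLc τ).symm
  rw [hcard, Nat.cast_sum]
  refine (Finset.sum_le_sum hLsmall).trans ?_
  rw [← Finset.mul_sum, ← Nat.cast_sum]
  have htot' : ((∑ τ ∈ 𝒯, (levelShadow t (L τ)).card : ℕ) : ℝ)
      ≤ 2 ^ k * (levelShadow t S).card := by exact_mod_cast htot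
  calc _ ≤ ξ * t.factorial * n ^ (s - t) * (2 ^ k * ((levelShadow t S).card : ℝ)) := by gcongr
    _ = _ := by ring

/-- A family with few `t`-intersections and no popular `(t+1)`-set is small compared with its
`t`-shadow. -/
theorem card_le_of_few_orderedPairs (k t s : ℕ) (ht : 1 ≤ t) (hk : k = t + 1 + s)
    (hs : t + 2 ≤ s) (η : ℝ) (hη : 0 < η) :
    ∃ c > (0 : ℝ), ∃ ν > (0 : ℝ), ∃ n₀ : ℕ, ∀ n ≥ n₀,
      ∀ R ⊆ (Finset.Icc 1 n).powersetCard k, ∀ σ : ℝ, ((levelShadow t R).card : ℝ) ≤ σ →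
      (∀ T : Finset ℕ, T.card = t + 1 → ((R.filter (fun G => T ⊆ G)).card : ℝ) ≤ ν * n ^ s) →
      (orderedPairs t R : ℝ) ≤ c * R.card * n ^ (s - t) →
      (R.card : ℝ) ≤ η * σ * n ^ (s - t) := by
  classical
  have hkpos : (1 : ℝ) ≤ k := by exact_mod_cast (by omega : 1 ≤ k)
  set θ : ℝ := 1 / (4 * k ^ 3) with hθ
  have hθ0 : 0 < θ := by positivity
  have hθ1 : θ ≤ 1 := by
    rw [hθ, div_le_one (by positivity)]
    nlinarith [one_le_pow₀ hkpos (n := 3)]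
  set m := Fintype.card (Finset (Fin k) × Fin k) with hm
  set θ' := θ ^ m with hθ'
  have hθ'0 : 0 < θ' := by positivity
  set ξ : ℝ := min 1 (θ' * η / (t.factorial * 2 ^ k * 2)) with hξ
  have hξ0 : 0 < ξ := by
    rw [hξ]; apply lt_min one_pos; positivity
  have hξ1 : ξ ≤ 1 := min_le_left _ _
  have hξ2 : ξ * t.factorial * 2 ^ k ≤ θ' * η / 2 := by
    have := min_le_right 1 (θ' * η / (t.factorial * 2 ^ k * 2))
    rw [← hξ, le_div_iff₀ (by positivity)] at this
    linarith
  obtain ⟨n₀, hn₀⟩ := exists_nat_gt (1 / (θ' * η))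
  refine ⟨θ' ^ 2 * η / 16, by positivity, ξ ^ s, by positivity, n₀ + 1, ?_⟩
  intro n hn R hR σ hσ hdeg hpairs
  by_contra! hlt
  have hσ0 : 0 ≤ σ := le_trans (by positivity) hσ
  have hnR : 1 / (θ' * η) < n := hn₀.trans (by exact_mod_cast hn)
  have hn1 : 1 < n * (θ' * η) := by
    rwa [div_lt_iff₀ (by positivity)] at hnR
  obtain ⟨S, hSR, hSc, hhom⟩ := exists_homogeneous (increasingEnum k) θ hθ0 hθ1 R
  rw [← hm, ← hθ'] at hSc
  have hSk : ∀ F ∈ S, F.card = k := fun F hF => (Finset.mem_powersetCard.1 (hR (hSR hF))).2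
  have hSσ : ((levelShadow t S).card : ℝ) ≤ σ := le_trans
    (by exact_mod_cast Finset.card_le_card (levelShadow_mono t hSR)) hσ
  have hSbig : θ' * (η * σ * n ^ (s - t)) < S.card := lt_of_lt_of_le (by gcongr) hSc
  have hx0 : 0 ≤ θ' * (η * σ * n ^ (s - t)) := by positivity
  have hSpos : (0 : ℝ) < S.card := lt_of_le_of_lt hx0 hSbig
  have hno : ∀ I, IsDetClosed (increasingEnum k) S I → I.card ≠ t := by
    intro I hI hIc
    have h1 := sq_card_le_orderedPairs k t S hSk θ
      (by rw [hθ]; field_simp; exact le_refl _) I hIc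
      (fun i hi => (hhom I i).resolve_left (hI i hi))
    have h2 : (orderedPairs t S : ℝ) ≤ θ' ^ 2 * η / 16 * R.card * n ^ (s - t) :=
      le_trans (by exact_mod_cast orderedPairs_mono t hSR) hpairs
    have h3 : (S.card : ℝ) ^ 2 ≤ (θ' * (η * σ * n ^ (s - t)) / 2) * S.card := by
      calc (S.card : ℝ) ^ 2 ≤ _ := h1
        _ ≤ 8 * σ * (θ' ^ 2 * η / 16 * R.card * n ^ (s - t)) := by gcongr
        _ = (θ' * (η * σ * n ^ (s - t)) / 2) * (θ' * R.card) := by ring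
        _ ≤ _ := by gcongr
    rw [sq] at h3
    have := le_of_mul_le_mul_right h3 hSpos
    linarith
  have hcov : ∀ S₀ : Finset (Fin k), S₀.card + t + 2 ≤ Fintype.card (Fin k) →
      ∃ K, IsDetClosed (increasingEnum k) S K ∧ S₀ ⊆ K ∧ K ≠ Finset.univ := by
    intro S₀ hS₀
    rw [Fintype.card_fin] at hS₀
    obtain ⟨B, hB1, -, hB3⟩ := Finset.exists_subsuperset_card_eq (Finset.subset_univ S₀)
      (n := s - 1) (by omega) (by rw [Finset.card_univ, Fintype.card_fin]; omega)
    obtain ⟨A, hAB, hA⟩ := Finset.exists_subset_card_eq (s := B) (n := t) (by omega)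
    obtain ⟨K, hK, hBK, hmem⟩ := exists_isDetClosed_iff_isDetermined (increasingEnum k) S B
    refine ⟨K, hK, hB1.trans hBK, ?_⟩
    rintro rfl
    have h1 := card_le_of_forall_isDetermined (hSR.trans hR) hAB
      (fun i => (hmem i).1 (Finset.mem_univ i))
    rw [hA, hB3] at h1
    have h2 : (S.card : ℝ) ≤ σ * n ^ (s - 1 - t) := by
      calc (S.card : ℝ) ≤ (levelShadow t S).card * n ^ (s - 1 - t) := by exact_mod_cast h1
        _ ≤ _ := by gcongr
    have h3 : (n : ℝ) ^ (s - t) = n * n ^ (s - 1 - t) := by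
      rw [← pow_succ']; congr 1; omega
    have h4 : σ * (n : ℝ) ^ (s - 1 - t) ≤ θ' * (η * σ * n ^ (s - t)) := by
      rw [h3]
      calc σ * (n : ℝ) ^ (s - 1 - t) = 1 * (σ * n ^ (s - 1 - t)) := by ring
        _ ≤ n * (θ' * η) * (σ * n ^ (s - 1 - t)) := by gcongr
        _ = _ := by ring
    linarith
  obtain ⟨T, hT, hTC⟩ := exists_kernel t (IsDetClosed (increasingEnum k) S)
    (fun _ _ hI hJ => hI.inter hJ) (fun i hi => absurd (Finset.mem_univ i) hi)
    (by rw [Fintype.card_fin]; omega) hno hcov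
  have h1 := card_le_of_kernel k t s n ht (by omega) hk ξ hξ0 hξ1 S hSk
    (fun T hT => le_trans (by
      exact_mod_cast Finset.card_le_card (Finset.filter_subset_filter _ hSR)) (hdeg T hT))
    T hT (fun W hW i hi => isDetermined_of_kernel hno hT hTC hW hi)
  have h2 : (S.card : ℝ) ≤ θ' * η / 2 * n ^ (s - t) * σ := by
    refine h1.trans ?_
    gcongr
  nlinarith

theorem exists_forall_le_factorial_mul_choose (a s : ℕ) (η : ℝ) (hη : 0 < η) :
    ∃ n₀ : ℕ, ∀ n ≥ n₀, (1 - η) * (n : ℝ) ^ s ≤ s.factorial * ((n - a).choose s : ℕ) := by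
  obtain ⟨m, hm⟩ := exists_nat_gt (s * (a + s) / η)
  refine ⟨m + a + s + 1, fun n hn => ?_⟩
  have hn0 : (0 : ℝ) < n := by exact_mod_cast (by omega : 0 < n)
  have h1 : (n - (a + s)) ^ s ≤ s.factorial * (n - a).choose s := by
    rw [← Nat.descFactorial_eq_factorial_mul_choose]
    refine le_trans ?_ (Nat.pow_sub_le_descFactorial (n - a) s)
    exact Nat.pow_le_pow_left (by omega) s
  have h2 : ((n : ℝ) - (a + s)) ^ s ≤ s.factorial * ((n - a).choose s : ℕ) := by
    have : (((n - (a + s) : ℕ) : ℝ)) ^ s ≤ s.factorial * ((n - a).choose s : ℕ) := by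
      exact_mod_cast h1
    rwa [Nat.cast_sub (by omega), Nat.cast_add] at this
  refine le_trans ?_ h2
  have h3 : (1 : ℝ) + s * (-((a + s) / n)) ≤ (1 + -((a + s) / n)) ^ s := by
    apply one_add_mul_le_pow
    have : ((a : ℝ) + s) / n ≤ 1 := by
      rw [div_le_one hn0]; exact_mod_cast (by omega : a + s ≤ n)
    linarith
  have h4 : (s : ℝ) * ((a + s) / n) ≤ η := by
    have h5 : (s : ℝ) * (a + s) / η < n := hm.trans (by exact_mod_cast (by omega : m < n))
    rw [div_lt_iff₀ hη] at h5
    rw [← mul_div_assoc, div_le_iff₀ hn0]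
    linarith
  have h6 : ((n : ℝ) - (a + s)) ^ s = (1 + -((a + s) / n)) ^ s * n ^ s := by
    rw [← mul_pow]; congr 1; field_simp; ring
  rw [h6]
  gcongr
  linarith

/-- Among families of `s`-sets with pairwise disjoint `t`-shadows and nearly maximal total size,
one family dominates. -/
theorem exists_dominant {ι : Type*} [DecidableEq ι] (s t n : ℕ) (ht : 1 ≤ t) (hts : t < s)
    (hn : 1 ≤ n) (I : Finset ι) (L : ι → Finset (Finset ℕ))
    (hL : ∀ i ∈ I, L i ⊆ (Finset.Icc 1 n).powersetCard s)
    (hdisj : (I : Set ι).PairwiseDisjoint fun i => levelShadow t (L i)) (η : ℝ) (hη1 : η < 1)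
    (hbig : (1 - η) * (n : ℝ) ^ s ≤ ∑ i ∈ I, (s.factorial : ℝ) * (L i).card) :
    ∃ i₀ ∈ I, ∑ i ∈ I.erase i₀, (s.factorial : ℝ) * (L i).card ≤ t * η * n ^ s := by
  have hn0 : (0 : ℝ) < n := by exact_mod_cast hn
  set a : ι → ℝ := fun i => t.factorial * (levelShadow t (L i)).card with ha
  have ha0 : ∀ i, 0 ≤ a i := fun i => by positivity
  have hIne : I.Nonempty := by
    rw [Finset.nonempty_iff_ne_empty]
    rintro rfl
    simp only [Finset.sum_empty] at hbig
    have : 0 < (1 - η) * (n : ℝ) ^ s := mul_pos (by linarith) (by positivity)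
    linarith
  have hasum : ∑ i ∈ I, a i ≤ (n : ℝ) ^ t := by
    rw [ha, ← Finset.mul_sum, ← Nat.cast_sum, ← Finset.card_biUnion hdisj]
    have h1 : (I.biUnion fun i => levelShadow t (L i)).card ≤ n.choose t := by
      have : (I.biUnion fun i => levelShadow t (L i)) ⊆ (Finset.Icc 1 n).powersetCard t := by
        intro V hV
        obtain ⟨i, hi, hV⟩ := Finset.mem_biUnion.1 hV
        obtain ⟨G, hG, hVG, hVc⟩ := mem_levelShadow.1 hV
        exact Finset.mem_powersetCard.2
          ⟨hVG.trans (Finset.mem_powersetCard.1 (hL i hi hG)).1, hVc⟩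
      have := Finset.card_le_card this
      simpa using this
    have h2 : t.factorial * n.choose t ≤ n ^ t := by
      rw [← Nat.descFactorial_eq_factorial_mul_choose]
      exact Nat.descFactorial_le_pow n t
    exact_mod_cast (Nat.mul_le_mul_left _ h1).trans h2
  obtain ⟨i₀, hi₀, hmax⟩ := Finset.exists_max_image I a hIne
  refine ⟨i₀, hi₀, ?_⟩
  set y : ℝ := a i₀ ^ ((t : ℝ)⁻¹) with hy
  have hy0 : 0 ≤ y := Real.rpow_nonneg (ha0 _) _
  have hyt : y ^ t = a i₀ := Real.rpow_inv_natCast_pow (ha0 _) (by omega)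
  have hyn : y ≤ n := by
    refine le_of_pow_le_pow_left₀ (n := t) (by omega) hn0.le ?_
    rw [hyt]
    exact (Finset.single_le_sum (fun i _ => ha0 i) hi₀).trans hasum
  have hKK : ∀ i ∈ I, (s.factorial : ℝ) * (L i).card ≤ y ^ (s - t) * a i := fun i hi =>
    card_le_card_levelShadow t ht y hy0 s hts.le (L i)
      (fun G hG => (Finset.mem_powersetCard.1 (hL i hi hG)).2) (by rw [hyt]; exact hmax i hi)
  have hsplit : (n : ℝ) ^ s = n ^ (s - t) * n ^ t := by rw [← pow_add]; congr 1; omega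
  have h1 : (1 - η) * (n : ℝ) ^ (s - t) ≤ y ^ (s - t) := by
    have : ((1 - η) * (n : ℝ) ^ (s - t)) * n ^ t ≤ y ^ (s - t) * n ^ t := by
      calc _ = (1 - η) * (n : ℝ) ^ s := by rw [hsplit]; ring
        _ ≤ _ := hbig
        _ ≤ ∑ i ∈ I, y ^ (s - t) * a i := Finset.sum_le_sum hKK
        _ = y ^ (s - t) * ∑ i ∈ I, a i := by rw [Finset.mul_sum]
        _ ≤ _ := by gcongr
    exact le_of_mul_le_mul_right this (by positivity)
  have h2 : 1 - η ≤ y / n := by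
    have h3 : 1 - η ≤ (y / n) ^ (s - t) := by
      rw [div_pow, le_div_iff₀ (by positivity)]; exact h1
    exact h3.trans (pow_le_of_le_one (by positivity) ((div_le_one hn0).2 hyn) (by omega))
  have h4 : (1 - t * η) * (n : ℝ) ^ t ≤ a i₀ := by
    have h5 : (1 : ℝ) + t * (-η) ≤ (1 + -η) ^ t := one_add_mul_le_pow (by linarith) t
    have h6 : (1 + -η) ^ t ≤ (y / n) ^ t := pow_le_pow_left₀ (by linarith) (by linarith) t
    rw [← hyt]
    have h7 : y ^ t = (y / n) ^ t * n ^ t := by rw [← mul_pow]; congr 1; field_simp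
    rw [h7]
    gcongr
    linarith
  have h8 : ∑ i ∈ I.erase i₀, a i ≤ t * η * n ^ t := by
    have := Finset.add_sum_erase I a hi₀
    linarith
  have h9 : ∑ i ∈ I.erase i₀, (s.factorial : ℝ) * (L i).card
      ≤ y ^ (s - t) * ∑ i ∈ I.erase i₀, a i := by
    rw [Finset.mul_sum]
    exact Finset.sum_le_sum fun i hi => hKK i (Finset.mem_of_mem_erase hi)
  have h10 : 0 ≤ ∑ i ∈ I.erase i₀, a i := Finset.sum_nonneg fun i _ => ha0 i
  have h11 : y ^ (s - t) * ∑ i ∈ I.erase i₀, a i ≤ (n : ℝ) ^ (s - t) * (t * η * n ^ t) :=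
    mul_le_mul (pow_le_pow_left₀ hy0 hyn _) h8 h10 (by positivity)
  have h12 : (n : ℝ) ^ (s - t) * (t * η * n ^ t) = t * η * n ^ s := by rw [hsplit]; ring
  exact h9.trans (h11.trans h12.le)

/-- If a `k`-set `R` meets few of the sets containing `T` in exactly `t` elements, then every
`t`-subset of `R` contains a set `S` for which few members of the family contain `T ∪ S`. -/
theorem exists_subset_of_few_intersections {n k t s : ℕ} (hk : k = t + 1 + s) (hs : t < s)
    (hn : 1 ≤ n) {F : Finset (Finset ℕ)} (hF : F ⊆ (Finset.Icc 1 n).powersetCard k)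
    {T R V : Finset ℕ} (hT : T.card = t + 1) (hR : R.card = k) (hTR : ¬ T ⊆ R) (hVR : V ⊆ R)
    (hV : V.card = t) {c : ℝ} (hc : (k : ℝ) ≤ c * n)
    (hfew : ((F.filter (fun G => T ⊆ G ∧ (G ∩ R).card = t)).card : ℝ) ≤ c * n ^ (s - t)) :
    ∃ S ⊆ V \ T, S.card ≤ t ∧
      ((F.filter (fun G => T ∪ S ⊆ G)).card : ℝ) ≤ 2 * c * n ^ (s - S.card) := by
  have hn1 : (1 : ℝ) ≤ n := by exact_mod_cast hn
  have hRT : (R ∩ T).card ≤ t := by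
    have : R ∩ T ⊂ T := by
      rw [Finset.ssubset_iff_of_subset Finset.inter_subset_right]
      obtain ⟨x, hx, hxR⟩ := Finset.not_subset.1 hTR
      exact ⟨x, hx, fun h => hxR (Finset.mem_inter.1 h).1⟩
    have := Finset.card_lt_card this
    omega
  have hVT : t - (R ∩ T).card ≤ (V \ T).card := by
    have h1 := Finset.card_sdiff_add_card_inter V T
    have h2 : (V ∩ T).card ≤ (R ∩ T).card :=
      Finset.card_le_card (Finset.inter_subset_inter_right hVR)
    omega
  obtain ⟨S, hSV, hS⟩ := Finset.exists_subset_card_eq hVT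
  have hdTS : Disjoint T S := by
    rw [Finset.disjoint_left]
    exact fun x hx hxS => (Finset.mem_sdiff.1 (hSV hxS)).2 hx
  have hSR : S ⊆ R := fun x hx => hVR (Finset.mem_sdiff.1 (hSV hx)).1
  have hTS : (T ∪ S).card = t + 1 + S.card := by rw [Finset.card_union_of_disjoint hdTS, hT]
  have hRTS : ((R ∩ T) ∪ S).card = t := by
    rw [Finset.card_union_of_disjoint (hdTS.mono_left Finset.inter_subset_right)]; omega
  refine ⟨S, hSV, by omega, ?_⟩
  have hsub : F.filter (fun G => T ∪ S ⊆ G) ⊆ F.filter (fun G => T ⊆ G ∧ (G ∩ R).card = t) ∪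
      (R \ (T ∪ S)).biUnion (fun x => F.filter (fun G => insert x (T ∪ S) ⊆ G)) := by
    intro G hG
    obtain ⟨hGF, hTSG⟩ := Finset.mem_filter.1 hG
    rw [Finset.mem_union]
    by_cases h : (G ∩ R).card = t
    · exact Or.inl (Finset.mem_filter.2 ⟨hGF, Finset.subset_union_left.trans hTSG, h⟩)
    · right
      have hne : ¬ G ∩ R ⊆ (R ∩ T) ∪ S := by
        intro h'
        apply h
        have h2 : (R ∩ T) ∪ S ⊆ G ∩ R := by
          intro x hx
          rcases Finset.mem_union.1 hx with hx | hx
          · rw [Finset.mem_inter] at hx ⊢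
            exact ⟨hTSG (Finset.mem_union_left _ hx.2), hx.1⟩
          · exact Finset.mem_inter.2 ⟨hTSG (Finset.mem_union_right _ hx), hSR hx⟩
        rw [Finset.Subset.antisymm h' h2, hRTS]
      obtain ⟨x, hx, hx'⟩ := Finset.not_subset.1 hne
      rw [Finset.mem_inter] at hx
      simp only [Finset.mem_union, Finset.mem_inter, not_or, not_and] at hx'
      refine Finset.mem_biUnion.2 ⟨x, ?_, ?_⟩
      · simp only [Finset.mem_sdiff, Finset.mem_union, not_or]
        exact ⟨hx.2, hx'.1 hx.2, hx'.2⟩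
      · exact Finset.mem_filter.2 ⟨hGF, Finset.insert_subset hx.1 hTSG⟩
  have hbi : ((R \ (T ∪ S)).biUnion
      (fun x => F.filter (fun G => insert x (T ∪ S) ⊆ G))).card ≤ k * n ^ (s - S.card - 1) := by
    refine Finset.card_biUnion_le.trans ?_
    have : ∀ x ∈ R \ (T ∪ S), (F.filter (fun G => insert x (T ∪ S) ⊆ G)).card
        ≤ n ^ (s - S.card - 1) := by
      intro x hx
      refine (card_filter_subset_le _ hF).trans (le_of_eq ?_)
      rw [Finset.card_insert_of_notMem (Finset.mem_sdiff.1 hx).2, hTS]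
      congr 1; omega
    refine (Finset.sum_le_sum this).trans ?_
    rw [Finset.sum_const, smul_eq_mul]
    apply Nat.mul_le_mul_right
    rw [← hR]
    exact Finset.card_le_card Finset.sdiff_subset
  have htot : ((F.filter (fun G => T ∪ S ⊆ G)).card : ℝ) ≤
      (F.filter (fun G => T ⊆ G ∧ (G ∩ R).card = t)).card + k * n ^ (s - S.card - 1) := by
    exact_mod_cast (Finset.card_le_card hsub).trans
      ((Finset.card_union_le _ _).trans (Nat.add_le_add_left hbi _))
  have hc0 : 0 ≤ c := by
    by_contra! h
    have : (0 : ℝ) ≤ k := by positivity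
    nlinarith
  have h1 : (k : ℝ) * n ^ (s - S.card - 1) ≤ c * n ^ (s - S.card) := by
    have : (n : ℝ) ^ (s - S.card) = n * n ^ (s - S.card - 1) := by
      rw [← pow_succ']; congr 1; omega
    rw [this, ← mul_assoc]
    gcongr
  have h2 : c * (n : ℝ) ^ (s - t) ≤ c * n ^ (s - S.card) := by
    gcongr
    omega
  linarith

theorem cast_card_biUnion_le_mul {ι α : Type*} [DecidableEq α] (I : Finset ι) (f : ι → Finset α)
    (b : ℝ) (h : ∀ i ∈ I, ((f i).card : ℝ) ≤ b) : ((I.biUnion f).card : ℝ) ≤ I.card * b := by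
  have h1 : ((I.biUnion f).card : ℝ) ≤ ∑ i ∈ I, ((f i).card : ℝ) := by
    exact_mod_cast Finset.card_biUnion_le
  refine h1.trans ((Finset.sum_le_sum h).trans ?_)
  rw [Finset.sum_const, nsmul_eq_mul]

theorem mul_card_le_orderedPairs {t : ℕ} {F N : Finset (Finset ℕ)} (T : Finset ℕ) (hN : N ⊆ F)
    (x : ℝ) (h : ∀ R ∈ N, x ≤ (F.filter (fun G => T ⊆ G ∧ (G ∩ R).card = t)).card) :
    x * N.card ≤ orderedPairs t F := by
  have h1 : ∀ R ∈ N, x ≤ ((F.filter (fun G => (R ∩ G).card = t)).card : ℝ) := by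
    intro R hR
    refine (h R hR).trans ?_
    have : F.filter (fun G => T ⊆ G ∧ (G ∩ R).card = t)
        ⊆ F.filter (fun G => (R ∩ G).card = t) := by
      intro G hG
      rw [Finset.mem_filter] at hG ⊢
      exact ⟨hG.1, by rw [Finset.inter_comm]; exact hG.2.2⟩
    exact_mod_cast Finset.card_le_card this
  calc x * N.card = ∑ R ∈ N, x := by rw [Finset.sum_const, nsmul_eq_mul, mul_comm]
    _ ≤ ∑ R ∈ N, ((F.filter (fun G => (R ∩ G).card = t)).card : ℝ) := Finset.sum_le_sum h1
    _ ≤ ∑ R ∈ F, ((F.filter (fun G => (R ∩ G).card = t)).card : ℝ) :=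
        Finset.sum_le_sum_of_subset_of_nonneg hN fun _ _ _ => by positivity
    _ = _ := by rw [orderedPairs_eq_sum]; push_cast; rfl

theorem card_popular_mul_le {n k j : ℕ} {F : Finset (Finset ℕ)}
    (hF : F ⊆ (Finset.Icc 1 n).powersetCard k) (x : ℝ) (𝒯 : Finset (Finset ℕ))
    (h𝒯 : ∀ T ∈ 𝒯, T.card = j ∧ x ≤ (F.filter (fun G => T ⊆ G)).card) :
    x * 𝒯.card ≤ 2 ^ k * F.card := by
  have h1 : ∑ T ∈ 𝒯, (F.filter (fun G => T ⊆ G)).card ≤ 2 ^ k * F.card := by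
    simp_rw [Finset.card_filter]
    rw [Finset.sum_comm]
    have : ∀ G ∈ F, (∑ T ∈ 𝒯, if T ⊆ G then 1 else 0) ≤ 2 ^ k := by
      intro G hG
      rw [← Finset.card_filter, ← (Finset.mem_powersetCard.1 (hF hG)).2, ← Finset.card_powerset]
      apply Finset.card_le_card
      intro T hT
      exact Finset.mem_powerset.2 (Finset.mem_filter.1 hT).2
    refine (Finset.sum_le_sum this).trans ?_
    rw [Finset.sum_const, smul_eq_mul, mul_comm]
  calc x * 𝒯.card = ∑ T ∈ 𝒯, x := by rw [Finset.sum_const, nsmul_eq_mul, mul_comm]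
    _ ≤ ∑ T ∈ 𝒯, ((F.filter (fun G => T ⊆ G)).card : ℝ) :=
        Finset.sum_le_sum fun T hT => (h𝒯 T hT).2
    _ ≤ _ := by exact_mod_cast h1

/-- The members of `F` containing `T ∪ S` for some set `S` of size at most `t` with unusually few
such members. -/
noncomputable def meagreUnion (F : Finset (Finset ℕ)) (n s t : ℕ) (c : ℝ) (T : Finset ℕ) :
    Finset (Finset ℕ) :=
  (Finset.range (t + 1)).biUnion fun i =>
    (((Finset.Icc 1 n).powersetCard i).filter (fun S =>
      ((F.filter (fun G => T ∪ S ⊆ G)).card : ℝ) ≤ c * n ^ (s - S.card))).biUnion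
      fun S => F.filter (fun G => T ∪ S ⊆ G)

theorem card_meagreUnion_le (F : Finset (Finset ℕ)) (n s t : ℕ) (hts : t < s) (c : ℝ) (hc : 0 ≤ c)
    (T : Finset ℕ) : ((meagreUnion F n s t c T).card : ℝ) ≤ (t + 1) * (c * n ^ s) := by
  have := cast_card_biUnion_le_mul (Finset.range (t + 1)) (fun i =>
    (((Finset.Icc 1 n).powersetCard i).filter (fun S =>
      ((F.filter (fun G => T ∪ S ⊆ G)).card : ℝ) ≤ c * n ^ (s - S.card))).biUnion
      fun S => F.filter (fun G => T ∪ S ⊆ G)) (c * n ^ s) ?_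
  · rw [Finset.card_range] at this
    push_cast at this
    exact this
  · intro i hi
    have hi' : i ≤ s := by
      have := Finset.mem_range.1 hi
      omega
    refine (cast_card_biUnion_le_mul _ _ (c * n ^ (s - i)) ?_).trans ?_
    · intro S hS
      rw [Finset.mem_filter, Finset.mem_powersetCard] at hS
      rw [← hS.1.2]
      exact hS.2
    · have h1 : ((((Finset.Icc 1 n).powersetCard i).filter (fun S =>
          ((F.filter (fun G => T ∪ S ⊆ G)).card : ℝ) ≤ c * n ^ (s - S.card))).card : ℝ)
          ≤ n ^ i := by
        have : (((Finset.Icc 1 n).powersetCard i).filter (fun S =>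
          ((F.filter (fun G => T ∪ S ⊆ G)).card : ℝ) ≤ c * n ^ (s - S.card))).card ≤ n ^ i := by
          refine (Finset.card_filter_le _ _).trans ?_
          rw [Finset.card_powersetCard, Nat.card_Icc, Nat.add_sub_cancel]
          exact Nat.choose_le_pow n i
        exact_mod_cast this
      calc _ ≤ (n : ℝ) ^ i * (c * n ^ (s - i)) := by gcongr
        _ = c * (n ^ i * n ^ (s - i)) := by ring
        _ = _ := by rw [← pow_add, Nat.add_sub_cancel' hi']

/-- Removing from `F` four exceptional families leaves disjoint-shadow links. -/
theorem pairwiseDisjoint_levelShadow_links {n k t s : ℕ} (hk : k = t + 1 + s) (hs : t < s)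
    (hn : 1 ≤ n) {F E : Finset (Finset ℕ)} (hF : F ⊆ (Finset.Icc 1 n).powersetCard k) (hEF : E ⊆ F)
    {c : ℝ} (hc : (k : ℝ) ≤ c * n) (𝒯 : Finset (Finset ℕ)) (h𝒯 : ∀ T ∈ 𝒯, T.card = t + 1)
    (hnormal : ∀ T ∈ 𝒯, ∀ R ∈ E, ¬ T ⊆ R →
      ((F.filter (fun G => T ⊆ G ∧ (G ∩ R).card = t)).card : ℝ) ≤ c * n ^ (s - t))
    (huniq : ∀ T ∈ 𝒯, ∀ T' ∈ 𝒯, T ≠ T' → ∀ G ∈ E, T ⊆ G → ¬ T' ⊆ G)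
    (hmeagre : ∀ T ∈ 𝒯, ∀ G ∈ E, G ∉ meagreUnion F n s t (2 * c) T) :
    (𝒯 : Set (Finset ℕ)).PairwiseDisjoint fun T =>
      levelShadow t ((E.filter (fun G => T ⊆ G)).image (fun G => G \ T)) := by
  intro T hT T' hT' hne
  rw [Function.onFun, Finset.disjoint_left]
  intro V hV hV'
  obtain ⟨_, hGT, hVG, hVc⟩ := mem_levelShadow.1 hV
  obtain ⟨G, hG, rfl⟩ := Finset.mem_image.1 hGT
  obtain ⟨_, hGT', hVG', -⟩ := mem_levelShadow.1 hV'
  obtain ⟨G', hG', rfl⟩ := Finset.mem_image.1 hGT'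
  rw [Finset.mem_filter] at hG hG'
  have hTG' : ¬ T ⊆ G' := huniq T' hT' T hT hne.symm G' hG'.1 hG'.2
  obtain ⟨S, hSV, hSt, hS⟩ := exists_subset_of_few_intersections hk hs hn hF (h𝒯 T hT)
    (Finset.mem_powersetCard.1 (hF (hEF hG'.1))).2 hTG' (hVG'.trans Finset.sdiff_subset) hVc hc
    (hnormal T hT G' hG'.1 hTG')
  have hSG : S ⊆ G := fun x hx => (Finset.mem_sdiff.1 (hVG (Finset.mem_sdiff.1 (hSV hx)).1)).1
  apply hmeagre T hT G hG.1
  rw [meagreUnion, Finset.mem_biUnion]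
  refine ⟨S.card, Finset.mem_range.2 (by omega), Finset.mem_biUnion.2 ⟨S, ?_, ?_⟩⟩
  · rw [Finset.mem_filter, Finset.mem_powersetCard]
    exact ⟨⟨hSG.trans (Finset.mem_powersetCard.1 (hF (hEF hG.1))).1, rfl⟩, hS⟩
  · exact Finset.mem_filter.2 ⟨hEF hG.1, Finset.union_subset hG.2 hSG⟩

set_option maxHeartbeats 1000000 in
/-- Stability: a family of nearly extremal size with few `t`-intersections is close to a family of
all sets containing a fixed `(t+1)`-set. -/
theorem exists_stability (k t s : ℕ) (ht : 1 ≤ t) (hk : k = t + 1 + s) (hs : t + 2 ≤ s) (δ : ℝ)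
    (hδ : 0 < δ) :
    ∃ ε > (0 : ℝ), ∃ n₀ : ℕ, ∀ n ≥ n₀, ∀ F ⊆ (Finset.Icc 1 n).powersetCard k,
      (n - (t + 1)).choose s ≤ F.card → (F.card : ℝ) ≤ 2 * n ^ s →
      (orderedPairs t F : ℝ) ≤ ε * n ^ s * n ^ (s - t) →
      ∃ T ⊆ Finset.Icc 1 n, T.card = t + 1 ∧
        ((F.filter (fun G => ¬ T ⊆ G)).card : ℝ) ≤ δ * n ^ s := by
  classical
  set q : ℝ := (s.factorial : ℝ) with hq
  have hq1 : 1 ≤ q := by rw [hq]; exact_mod_cast Nat.factorial_pos s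
  set η : ℝ := min (1 / (2 * (1 + 4 * q))) (δ / (4 + t * (1 + 4 * q))) with hη
  have hη0 : 0 < η := by
    rw [hη]; apply lt_min <;> positivity
  have hη1 : (1 + 4 * q) * η < 1 := by
    have h1 := min_le_left (1 / (2 * (1 + 4 * q))) (δ / (4 + t * (1 + 4 * q)))
    rw [← hη, le_div_iff₀ (by positivity)] at h1
    linarith
  have hη2 : 4 * η + t * ((1 + 4 * q) * η) ≤ δ := by
    have h1 := min_le_right (1 / (2 * (1 + 4 * q))) (δ / (4 + t * (1 + 4 * q)))
    rw [← hη, le_div_iff₀ (by positivity)] at h1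
    linarith
  obtain ⟨cK, hcK, ν, hν, nK, hK⟩ := card_le_of_few_orderedPairs k t s ht hk hs η hη0
  obtain ⟨nC, hC⟩ := exists_forall_le_factorial_mul_choose (t + 1) s η hη0
  set M : ℝ := 2 ^ (k + 1) / ν with hM
  have hM0 : 0 < M := by positivity
  set c : ℝ := η / (2 * (t + 1) * M) with hc
  have hc0 : 0 < c := by positivity
  set ε : ℝ := min (cK * η) (η * c / M) with hε
  have hε0 : 0 < ε := by
    rw [hε]; apply lt_min <;> positivity
  obtain ⟨n₁, hn₁⟩ := exists_nat_gt (M ^ 2 / η)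
  obtain ⟨n₂, hn₂⟩ := exists_nat_gt ((k : ℝ) / c)
  refine ⟨ε, hε0, nK + nC + n₁ + n₂ + 1, ?_⟩
  intro n hn F hF hF1 hF2 hpairs
  have hn1 : 1 ≤ n := by omega
  have hn0 : (0 : ℝ) < n := by exact_mod_cast hn1
  have hnM : M ^ 2 ≤ η * n := by
    have : M ^ 2 / η < n := hn₁.trans (by exact_mod_cast (by omega : n₁ < n))
    rw [div_lt_iff₀ hη0] at this
    linarith
  have hnk : (k : ℝ) ≤ c * n := by
    have : (k : ℝ) / c < n := hn₂.trans (by exact_mod_cast (by omega : n₂ < n))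
    rw [div_lt_iff₀ hc0] at this
    linarith
  set 𝒯 := ((Finset.Icc 1 n).powersetCard (t + 1)).filter
    (fun T => ν * n ^ s < ((F.filter (fun G => T ⊆ G)).card : ℝ)) with h𝒯
  have h𝒯c : ∀ T ∈ 𝒯, T.card = t + 1 := fun T hT =>
    (Finset.mem_powersetCard.1 (Finset.mem_filter.1 hT).1).2
  have h𝒯M : (𝒯.card : ℝ) ≤ M := by
    have h1 := card_popular_mul_le hF (ν * n ^ s) 𝒯
      (fun T hT => ⟨h𝒯c T hT, (Finset.mem_filter.1 hT).2.le⟩)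
    have h2 : (ν * 𝒯.card) * (n : ℝ) ^ s ≤ 2 ^ (k + 1) * n ^ s := by
      calc (ν * 𝒯.card) * (n : ℝ) ^ s = ν * n ^ s * 𝒯.card := by ring
        _ ≤ _ := h1
        _ ≤ 2 ^ k * (2 * n ^ s) := by gcongr
        _ = _ := by ring
    rw [hM, le_div_iff₀ hν, mul_comm]
    exact le_of_mul_le_mul_right h2 (by positivity)
  set F₀ := F.filter (fun G => ∀ T ∈ 𝒯, ¬ T ⊆ G) with hF₀
  have hF₀F : F₀ ⊆ F := Finset.filter_subset _ _
  have hF₀c : (F₀.card : ℝ) ≤ η * n ^ s := by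
    by_contra! hlt
    have hsplit : (n : ℝ) ^ s = n ^ t * n ^ (s - t) := by rw [← pow_add]; congr 1; omega
    have h1 := hK n (by omega) F₀ (hF₀F.trans hF) ((n : ℝ) ^ t) (by
      have h2 : levelShadow t F₀ ⊆ (Finset.Icc 1 n).powersetCard t := by
        intro V hV
        obtain ⟨G, hG, hVG, hVc⟩ := mem_levelShadow.1 hV
        exact Finset.mem_powersetCard.2
          ⟨hVG.trans (Finset.mem_powersetCard.1 (hF (hF₀F hG))).1, hVc⟩
      have h3 := Finset.card_le_card h2
      rw [Finset.card_powersetCard, Nat.card_Icc, Nat.add_sub_cancel] at h3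
      exact_mod_cast h3.trans (Nat.choose_le_pow n t)) ?_ ?_
    · rw [mul_assoc, ← hsplit] at h1
      linarith
    · intro T hT
      by_contra! h2
      have hne : (F₀.filter (fun G => T ⊆ G)).Nonempty := by
        rw [← Finset.card_pos]
        have : (0 : ℝ) < (F₀.filter (fun G => T ⊆ G)).card := lt_of_le_of_lt (by positivity) h2
        exact_mod_cast this
      obtain ⟨G, hG⟩ := hne
      rw [Finset.mem_filter] at hG
      have hG' := Finset.mem_filter.1 hG.1
      refine hG'.2 T ?_ hG.2
      rw [h𝒯, Finset.mem_filter, Finset.mem_powersetCard]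
      refine ⟨⟨hG.2.trans (Finset.mem_powersetCard.1 (hF hG'.1)).1, hT⟩, h2.trans_le ?_⟩
      exact_mod_cast Finset.card_le_card (Finset.filter_subset_filter _ hF₀F)
    · have h2 : (orderedPairs t F₀ : ℝ) ≤ ε * n ^ s * n ^ (s - t) :=
        le_trans (by exact_mod_cast orderedPairs_mono t hF₀F) hpairs
      refine h2.trans ?_
      have h3 : ε ≤ cK * η := min_le_left _ _
      calc ε * n ^ s * n ^ (s - t) ≤ (cK * η) * n ^ s * (n : ℝ) ^ (s - t) := by gcongr
        _ = cK * (η * n ^ s) * n ^ (s - t) := by ring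
        _ ≤ _ := by gcongr
  set F₁ := 𝒯.biUnion (fun T => F.filter (fun R => ¬ T ⊆ R ∧ c * n ^ (s - t) <
    ((F.filter (fun G => T ⊆ G ∧ (G ∩ R).card = t)).card : ℝ))) with hF₁
  have hF₁c : (F₁.card : ℝ) ≤ η * n ^ s := by
    refine (cast_card_biUnion_le_mul _ _ (η / M * n ^ s) ?_).trans ?_
    · intro T _
      have h1 := mul_card_le_orderedPairs (t := t) T (Finset.filter_subset (fun R => ¬ T ⊆ R ∧
        c * n ^ (s - t) < ((F.filter (fun G => T ⊆ G ∧ (G ∩ R).card = t)).card : ℝ)) F)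
        (c * n ^ (s - t)) (fun R hR => (Finset.mem_filter.1 hR).2.2.le)
      have h2 : ε ≤ η * c / M := min_le_right _ _
      have h3 := h1.trans (hpairs.trans (mul_le_mul_of_nonneg_right
        (mul_le_mul_of_nonneg_right h2 (by positivity)) (by positivity)))
      have h4 : (0 : ℝ) < c * n ^ (s - t) := by positivity
      refine le_of_mul_le_mul_left (h3.trans (le_of_eq ?_)) h4
      ring
    · calc (𝒯.card : ℝ) * (η / M * n ^ s) ≤ M * (η / M * n ^ s) := by gcongr
        _ = _ := by field_simp
  set F₂ := 𝒯.offDiag.biUnion (fun p => F.filter (fun G => p.1 ∪ p.2 ⊆ G)) with hF₂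
  have hF₂c : (F₂.card : ℝ) ≤ η * n ^ s := by
    refine (cast_card_biUnion_le_mul _ _ ((n : ℝ) ^ (s - 1)) ?_).trans ?_
    · rintro ⟨T, T'⟩ hp
      rw [Finset.mem_offDiag] at hp
      obtain ⟨hT, hT', hne⟩ := hp
      dsimp only at hT hT' hne ⊢
      have h1 : t + 2 ≤ (T ∪ T').card := by
        have : T ⊂ T ∪ T' := by
          rw [Finset.ssubset_iff_subset_ne]
          refine ⟨Finset.subset_union_left, fun h => hne ?_⟩
          have : T' ⊆ T := by rw [h]; exact Finset.subset_union_right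
          exact (Finset.eq_of_subset_of_card_le this (by rw [h𝒯c T hT, h𝒯c T' hT'])).symm
        have := Finset.card_lt_card this
        rw [h𝒯c T hT] at this
        omega
      have h2 := card_filter_subset_le (T ∪ T') hF
      have h3 : n ^ (k - (T ∪ T').card) ≤ n ^ (s - 1) := Nat.pow_le_pow_right hn1 (by omega)
      exact_mod_cast h2.trans h3
    · have h1 : (𝒯.offDiag.card : ℝ) ≤ M ^ 2 := by
        have : 𝒯.offDiag.card ≤ 𝒯.card * 𝒯.card := by
          rw [Finset.offDiag_card]; exact Nat.sub_le _ _
        calc (𝒯.offDiag.card : ℝ) ≤ 𝒯.card * 𝒯.card := by exact_mod_cast this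
          _ ≤ M * M := by gcongr
          _ = _ := by ring
      have h2 : (n : ℝ) ^ s = n * n ^ (s - 1) := by rw [← pow_succ']; congr 1; omega
      calc _ ≤ M ^ 2 * (n : ℝ) ^ (s - 1) := by gcongr
        _ ≤ (η * n) * (n : ℝ) ^ (s - 1) := by gcongr
        _ = _ := by rw [h2]; ring
  set F₃ := 𝒯.biUnion (fun T => meagreUnion F n s t (2 * c) T) with hF₃
  have hF₃c : (F₃.card : ℝ) ≤ η * n ^ s := by
    refine (cast_card_biUnion_le_mul _ _ _ (fun T _ =>
      card_meagreUnion_le F n s t (by omega) (2 * c) (by positivity) T)).trans ?_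
    calc (𝒯.card : ℝ) * ((t + 1) * (2 * c * n ^ s)) ≤ M * ((t + 1) * (2 * c * n ^ s)) := by gcongr
      _ = _ := by rw [hc]; field_simp
  set B := F₀ ∪ F₁ ∪ F₂ ∪ F₃ with hB
  have hBc : (B.card : ℝ) ≤ 4 * η * n ^ s := by
    have : B.card ≤ F₀.card + F₁.card + F₂.card + F₃.card := by
      have h1 := Finset.card_union_le (F₀ ∪ F₁ ∪ F₂) F₃
      have h2 := Finset.card_union_le (F₀ ∪ F₁) F₂
      have h3 := Finset.card_union_le F₀ F₁
      rw [hB]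
      omega
    have : (B.card : ℝ) ≤ F₀.card + F₁.card + F₂.card + F₃.card := by exact_mod_cast this
    linarith
  set E := F \ B with hE
  have hEF : E ⊆ F := Finset.sdiff_subset
  have hEB : ∀ G ∈ E, G ∉ F₀ ∧ G ∉ F₁ ∧ G ∉ F₂ ∧ G ∉ F₃ := by
    intro G hG
    have := (Finset.mem_sdiff.1 hG).2
    simp only [hB, Finset.mem_union, not_or] at this
    exact ⟨this.1.1.1, this.1.1.2, this.1.2, this.2⟩
  set L : Finset ℕ → Finset (Finset ℕ) := fun T =>
    (E.filter (fun G => T ⊆ G)).image (fun G => G \ T) with hL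
  have hLc : ∀ T, (L T).card = (E.filter (fun G => T ⊆ G)).card := by
    intro T
    apply Finset.card_image_of_injOn
    intro G hG H hH h
    have hG' := Finset.mem_filter.1 (Finset.mem_coe.1 hG)
    have hH' := Finset.mem_filter.1 (Finset.mem_coe.1 hH)
    rw [← Finset.sdiff_union_of_subset hG'.2, ← Finset.sdiff_union_of_subset hH'.2]
    exact congrArg (· ∪ T) h
  have hcover : ∀ G ∈ E, ∃ T ∈ 𝒯, T ⊆ G := by
    intro G hG
    by_contra! h
    exact (hEB G hG).1 (Finset.mem_filter.2 ⟨hEF hG, h⟩)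
  have hdisj := pairwiseDisjoint_levelShadow_links hk (by omega) hn1 hF hEF hnk 𝒯 h𝒯c
    (by
      intro T hT R hR hTR
      by_contra! h
      exact (hEB R hR).2.1 (Finset.mem_biUnion.2
        ⟨T, hT, Finset.mem_filter.2 ⟨hEF hR, hTR, h⟩⟩))
    (by
      intro T hT T' hT' hne G hG hTG hTG'
      exact (hEB G hG).2.2.1 (Finset.mem_biUnion.2 ⟨(T, T'), Finset.mem_offDiag.2 ⟨hT, hT', hne⟩,
        Finset.mem_filter.2 ⟨hEF hG, Finset.union_subset hTG hTG'⟩⟩))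
    (by
      intro T hT G hG h
      exact (hEB G hG).2.2.2 (Finset.mem_biUnion.2 ⟨T, hT, h⟩))
  have hLs : ∀ T ∈ 𝒯, L T ⊆ (Finset.Icc 1 n).powersetCard s := by
    intro T hT V hV
    obtain ⟨G, hG, rfl⟩ := Finset.mem_image.1 hV
    rw [Finset.mem_filter] at hG
    have hG' := Finset.mem_powersetCard.1 (hF (hEF hG.1))
    rw [Finset.mem_powersetCard, Finset.card_sdiff_of_subset hG.2, hG'.2, h𝒯c T hT]
    exact ⟨Finset.sdiff_subset.trans hG'.1, by omega⟩
  have hEcard : (E.card : ℝ) ≤ ∑ T ∈ 𝒯, ((L T).card : ℝ) := by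
    have h1 : E ⊆ 𝒯.biUnion (fun T => E.filter (fun G => T ⊆ G)) := by
      intro G hG
      obtain ⟨T, hT, hTG⟩ := hcover G hG
      exact Finset.mem_biUnion.2 ⟨T, hT, Finset.mem_filter.2 ⟨hG, hTG⟩⟩
    have h2 := (Finset.card_le_card h1).trans Finset.card_biUnion_le
    simp_rw [hLc]
    exact_mod_cast h2
  have hbig : (1 - (1 + 4 * q) * η) * (n : ℝ) ^ s ≤ ∑ T ∈ 𝒯, (s.factorial : ℝ) * (L T).card := by
    rw [← Finset.mul_sum, ← hq]
    have h1 : (F.card : ℝ) ≤ E.card + B.card := by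
      have : F.card ≤ E.card + B.card := by
        rw [hE]
        have := Finset.card_le_card_sdiff_add_card (s := F) (t := B)
        omega
      exact_mod_cast this
    have h2 : (((n - (t + 1)).choose s : ℕ) : ℝ) ≤ F.card := by exact_mod_cast hF1
    have h3 := hC n (by omega)
    rw [← hq] at h3
    have h4 : (((n - (t + 1)).choose s : ℕ) : ℝ) - 4 * η * n ^ s ≤ ∑ T ∈ 𝒯, ((L T).card : ℝ) := by
      linarith
    have h5 := mul_le_mul_of_nonneg_left h4 (zero_le_one.trans hq1)
    rw [mul_sub] at h5
    linarith
  obtain ⟨T₀, hT₀, hdom⟩ := exists_dominant s t n ht (by omega) hn1 𝒯 L hLs hdisj _ hη1 hbig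
  refine ⟨T₀, (Finset.mem_powersetCard.1 (Finset.mem_filter.1 hT₀).1).1, h𝒯c T₀ hT₀, ?_⟩
  have h1 : F.filter (fun G => ¬ T₀ ⊆ G) ⊆
      B ∪ (𝒯.erase T₀).biUnion (fun T => E.filter (fun G => T ⊆ G)) := by
    intro G hG
    rw [Finset.mem_filter] at hG
    rw [Finset.mem_union]
    by_cases hGB : G ∈ B
    · exact Or.inl hGB
    · right
      have hGE : G ∈ E := Finset.mem_sdiff.2 ⟨hG.1, hGB⟩
      obtain ⟨T, hT, hTG⟩ := hcover G hGE
      refine Finset.mem_biUnion.2 ⟨T, Finset.mem_erase.2 ⟨?_, hT⟩, Finset.mem_filter.2 ⟨hGE, hTG⟩⟩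
      rintro rfl
      exact hG.2 hTG
  have h2 : ((F.filter (fun G => ¬ T₀ ⊆ G)).card : ℝ) ≤
      B.card + ∑ T ∈ 𝒯.erase T₀, ((L T).card : ℝ) := by
    simp_rw [hLc]
    exact_mod_cast (Finset.card_le_card h1).trans
      ((Finset.card_union_le _ _).trans (Nat.add_le_add_left Finset.card_biUnion_le _))
  have h3 : ∑ T ∈ 𝒯.erase T₀, ((L T).card : ℝ) ≤ t * ((1 + 4 * q) * η) * n ^ s := by
    refine le_trans ?_ hdom
    apply Finset.sum_le_sum
    intro T _
    exact le_mul_of_one_le_left (by positivity) hq1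
  calc _ ≤ _ := h2
    _ ≤ 4 * η * n ^ s + t * ((1 + 4 * q) * η) * n ^ s := add_le_add hBc h3
    _ = (4 * η + t * ((1 + 4 * q) * η)) * n ^ s := by ring
    _ ≤ _ := by gcongr

theorem card_filter_subset_powersetCard {α : Type*} [DecidableEq α] {Z U : Finset α} {k : ℕ}
    (hU : U ⊆ Z) (hk : U.card ≤ k) :
    ((Z.powersetCard k).filter (fun G => U ⊆ G)).card = (Z.card - U.card).choose (k - U.card) := by
  rw [← Finset.card_sdiff_of_subset hU, ← Finset.card_powersetCard]
  apply Finset.card_nbij' (fun G => G \ U) (fun G => G ∪ U)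
  · intro G hG
    simp only [Finset.coe_filter, Finset.mem_powersetCard, Set.mem_ofPred_eq] at hG
    rw [Finset.mem_coe, Finset.mem_powersetCard, Finset.card_sdiff_of_subset hG.2, hG.1.2]
    exact ⟨Finset.sdiff_subset_sdiff hG.1.1 subset_rfl, rfl⟩
  · intro G hG
    rw [Finset.mem_coe, Finset.mem_powersetCard] at hG
    have hd : Disjoint G U := Finset.disjoint_of_subset_left hG.1 Finset.sdiff_disjoint
    simp only [Finset.coe_filter, Finset.mem_powersetCard, Set.mem_ofPred_eq]
    refine ⟨⟨Finset.union_subset (hG.1.trans Finset.sdiff_subset) hU, ?_⟩,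
      Finset.subset_union_right⟩
    rw [Finset.card_union_of_disjoint hd, hG.2]
    omega
  · intro G hG
    simp only [Finset.coe_filter, Finset.mem_powersetCard, Set.mem_ofPred_eq] at hG
    exact Finset.sdiff_union_of_subset hG.2
  · intro G hG
    rw [Finset.mem_coe, Finset.mem_powersetCard] at hG
    exact Finset.union_sdiff_cancel_right
      (Finset.disjoint_of_subset_left hG.1 Finset.sdiff_disjoint)

theorem exists_forall_mul_pow_le_choose (t s : ℕ) :
    ∃ b > (0 : ℝ), ∃ n₀ : ℕ, ∀ n ≥ n₀, ∀ i ≤ t,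
      b * (n : ℝ) ^ (s - i) ≤ ((n - (t + 1 + i)).choose (s - i) : ℕ) := by
  choose N hN using fun i : ℕ =>
    exists_forall_le_factorial_mul_choose (t + 1 + i) (s - i) (1 / 2) (by norm_num)
  refine ⟨1 / (2 * s.factorial), by positivity, (Finset.range (t + 1)).sup N, ?_⟩
  intro n hn i hi
  have h1 := hN i n (le_trans (Finset.le_sup (Finset.mem_range.2 (by omega))) hn)
  have h2 : ((s - i).factorial : ℝ) ≤ s.factorial := by
    exact_mod_cast Nat.factorial_le (Nat.sub_le s i)
  have h3 : (1 - 1 / 2) * (n : ℝ) ^ (s - i)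
      ≤ s.factorial * ((n - (t + 1 + i)).choose (s - i) : ℕ) := h1.trans (by gcongr)
  have h4 : (0 : ℝ) < s.factorial := by exact_mod_cast Nat.factorial_pos s
  rw [one_div, inv_mul_le_iff₀ (by positivity)]
  linarith

/-- The `t`-shadow of the sets meeting few members containing `T` is controlled by the number of
missing members containing `T`. -/
theorem card_levelShadow_mul_le {n k t s : ℕ} (hk : k = t + 1 + s) (hs : t < s)
    (hn : 1 ≤ n) {F R : Finset (Finset ℕ)} (hF : F ⊆ (Finset.Icc 1 n).powersetCard k) (hRF : R ⊆ F)
    {T : Finset ℕ} (hTn : T ⊆ Finset.Icc 1 n) (hT : T.card = t + 1) {b : ℝ} (hb0 : 0 < b)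
    (hb : ∀ i ≤ t, b * (n : ℝ) ^ (s - i) ≤ ((n - (t + 1 + i)).choose (s - i) : ℕ))
    (hbn : (k : ℝ) ≤ b / 4 * n) (hTR : ∀ A ∈ R, ¬ T ⊆ A)
    (hfew : ∀ A ∈ R, ((F.filter (fun G => T ⊆ G ∧ (G ∩ A).card = t)).card : ℝ)
      ≤ b / 4 * n ^ (s - t)) :
    ((levelShadow t R).card : ℝ) * n ^ (s - t) ≤ (t + 1) * (2 ^ (k + 1) / b) *
      ((((Finset.Icc 1 n).powersetCard k).filter (fun G => T ⊆ G)) \ F).card := by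
  classical
  have hn0 : (0 : ℝ) < n := by exact_mod_cast hn
  set D := (((Finset.Icc 1 n).powersetCard k).filter (fun G => T ⊆ G)) \ F with hD
  have hDk : D ⊆ (Finset.Icc 1 n).powersetCard k :=
    Finset.sdiff_subset.trans (Finset.filter_subset _ _)
  set Bad : ℕ → Finset (Finset ℕ) := fun i => ((Finset.Icc 1 n \ T).powersetCard i).filter
    (fun S => ((F.filter (fun G => T ∪ S ⊆ G)).card : ℝ) ≤ b / 2 * n ^ (s - i)) with hBad
  have hBadT : ∀ i, ∀ S ∈ Bad i, S ⊆ Finset.Icc 1 n \ T ∧ S.card = i ∧ Disjoint T S := by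
    intro i S hS
    have h1 := Finset.mem_powersetCard.1 (Finset.mem_filter.1 hS).1
    exact ⟨h1.1, h1.2, (Finset.disjoint_of_subset_left h1.1 Finset.sdiff_disjoint).symm⟩
  have hBadc : ∀ i ≤ t, ((Bad i).card : ℝ) * n ^ (s - i) ≤ 2 ^ (k + 1) / b * D.card := by
    intro i hi
    have h1 := card_popular_mul_le (j := t + 1 + i) hDk (b / 2 * n ^ (s - i))
      ((Bad i).image (fun S => T ∪ S)) (by
        intro U hU
        obtain ⟨S, hS, rfl⟩ := Finset.mem_image.1 hU
        obtain ⟨hSn, hSi, hdS⟩ := hBadT i S hS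
        have hTS : (T ∪ S).card = t + 1 + i := by rw [Finset.card_union_of_disjoint hdS, hT, hSi]
        refine ⟨hTS, ?_⟩
        have h2 := card_filter_subset_powersetCard (Z := Finset.Icc 1 n) (U := T ∪ S) (k := k)
          (Finset.union_subset hTn (hSn.trans Finset.sdiff_subset)) (by omega)
        rw [Nat.card_Icc, Nat.add_sub_cancel, hTS, show k - (t + 1 + i) = s - i by omega] at h2
        have h3 : ((Finset.Icc 1 n).powersetCard k).filter (fun G => T ∪ S ⊆ G) ⊆
            F.filter (fun G => T ∪ S ⊆ G) ∪ D.filter (fun G => T ∪ S ⊆ G) := by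
          intro G hG
          rw [Finset.mem_filter] at hG
          rw [Finset.mem_union, Finset.mem_filter, Finset.mem_filter]
          by_cases hGF : G ∈ F
          · exact Or.inl ⟨hGF, hG.2⟩
          · refine Or.inr ⟨Finset.mem_sdiff.2 ⟨Finset.mem_filter.2 ⟨hG.1, ?_⟩, hGF⟩, hG.2⟩
            exact Finset.subset_union_left.trans hG.2
        have h4 := (Finset.card_le_card h3).trans (Finset.card_union_le _ _)
        rw [h2] at h4
        have h5 : (((n - (t + 1 + i)).choose (s - i) : ℕ) : ℝ) ≤
            (F.filter (fun G => T ∪ S ⊆ G)).card + (D.filter (fun G => T ∪ S ⊆ G)).card := by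
          exact_mod_cast h4
        have h6 := (Finset.mem_filter.1 hS).2
        have h7 := hb i hi
        linarith)
    rw [Finset.card_image_of_injOn (by
      intro S hS S' hS' h
      have h1 := (hBadT i S hS).2.2
      have h2 := (hBadT i S' hS').2.2
      rw [← Finset.union_sdiff_cancel_left h1, ← Finset.union_sdiff_cancel_left h2]
      exact congrArg (· \ T) h)] at h1
    rw [div_mul_eq_mul_div, le_div_iff₀ hb0, pow_succ]
    linarith
  have hsub : levelShadow t R ⊆ (Finset.range (t + 1)).biUnion (fun i =>
      (Bad i).biUnion (fun S => ((Finset.Icc 1 n).powersetCard t).filter (fun V => S ⊆ V))) := by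
    intro V hV
    obtain ⟨A, hA, hVA, hVc⟩ := mem_levelShadow.1 hV
    have hAk := Finset.mem_powersetCard.1 (hF (hRF hA))
    obtain ⟨S, hSV, hSt, hS⟩ := exists_subset_of_few_intersections hk hs hn hF hT hAk.2
      (hTR A hA) hVA hVc hbn (hfew A hA)
    have hVn : V ⊆ Finset.Icc 1 n := hVA.trans hAk.1
    refine Finset.mem_biUnion.2 ⟨S.card, Finset.mem_range.2 (by omega),
      Finset.mem_biUnion.2 ⟨S, ?_, ?_⟩⟩
    · rw [hBad, Finset.mem_filter, Finset.mem_powersetCard]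
      refine ⟨⟨hSV.trans (Finset.sdiff_subset_sdiff hVn subset_rfl), rfl⟩, ?_⟩
      rwa [show b / 2 = 2 * (b / 4) by ring]
    · rw [Finset.mem_filter, Finset.mem_powersetCard]
      exact ⟨⟨hVn, hVc⟩, hSV.trans Finset.sdiff_subset⟩
  have hterm : ∀ i ∈ Finset.range (t + 1), (((Bad i).biUnion
      (fun S => ((Finset.Icc 1 n).powersetCard t).filter (fun V => S ⊆ V))).card : ℝ)
      ≤ 2 ^ (k + 1) / b * D.card / n ^ (s - t) := by
    intro i hi
    have hi' : i ≤ t := Nat.lt_succ_iff.1 (Finset.mem_range.1 hi)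
    refine (cast_card_biUnion_le_mul _ _ ((n : ℝ) ^ (t - i)) ?_).trans ?_
    · intro S hS
      have h1 := card_filter_subset_le (n := n) S
        (Finset.Subset.refl ((Finset.Icc 1 n).powersetCard t))
      rw [(hBadT i S hS).2.1] at h1
      exact_mod_cast h1
    · rw [le_div_iff₀ (by positivity), mul_assoc, ← pow_add, show t - i + (s - t) = s - i by omega]
      exact hBadc i hi'
  have h1 : ((levelShadow t R).card : ℝ) ≤ (t + 1) * (2 ^ (k + 1) / b * D.card / n ^ (s - t)) := by
    have h2 := cast_card_biUnion_le_mul (Finset.range (t + 1)) _ _ hterm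
    rw [Finset.card_range, Nat.cast_add, Nat.cast_one] at h2
    exact le_trans (by exact_mod_cast Finset.card_le_card hsub) h2
  have h2 : (0 : ℝ) < (n : ℝ) ^ (s - t) := by positivity
  calc _ ≤ (t + 1) * (2 ^ (k + 1) / b * D.card / n ^ (s - t)) * (n : ℝ) ^ (s - t) := by gcongr
    _ = _ := by field_simp

set_option maxHeartbeats 1000000 in
/-- Supersaturation just above the size of a star. -/
theorem exists_mul_le_orderedPairs (k t s : ℕ) (ht : 1 ≤ t) (hk : k = t + 1 + s)
    (hs : t + 2 ≤ s) :
    ∃ c > (0 : ℝ), ∃ ε > (0 : ℝ), ∃ n₀ : ℕ, ∀ n ≥ n₀, ∀ r : ℕ, 1 ≤ r → (r : ℝ) ≤ ε * n ^ s →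
      ∀ F ⊆ (Finset.Icc 1 n).powersetCard k, F.card = (n - (t + 1)).choose s + r →
      c * r * n ^ (s - t) ≤ orderedPairs t F := by
  classical
  obtain ⟨b, hb, nb, hnb⟩ := exists_forall_mul_pow_le_choose t s
  set K : ℝ := (t + 1) * (2 ^ (k + 1) / b) with hK
  have hK0 : 0 < K := by positivity
  obtain ⟨cK, hcK, ν, hν, nK, hKL⟩ :=
    card_le_of_few_orderedPairs k t s ht hk hs (1 / (4 * K)) (by positivity)
  obtain ⟨ε, hε, nS, hS⟩ := exists_stability k t s ht hk hs ν hν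
  set c : ℝ := min 1 (min (b / 8) (cK / 2)) with hc
  have hc0 : 0 < c := by rw [hc]; positivity
  have hc1 : c ≤ 1 := min_le_left _ _
  have hc2 : c ≤ b / 8 := (min_le_right _ _).trans (min_le_left _ _)
  have hc3 : c ≤ cK / 2 := (min_le_right _ _).trans (min_le_right _ _)
  obtain ⟨n₁, hn₁⟩ := exists_nat_gt ((k : ℝ) / (b / 4))
  refine ⟨c, hc0, min ε 1, lt_min hε one_pos, nb + nK + nS + n₁ + 1, ?_⟩
  intro n hn r hr hrε F hF hFc
  by_contra! hlt
  have hn1 : 1 ≤ n := by omega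
  have hn0 : (0 : ℝ) < n := by exact_mod_cast hn1
  have hnk : (k : ℝ) ≤ b / 4 * n := by
    have : (k : ℝ) / (b / 4) < n := hn₁.trans (by exact_mod_cast (by omega : n₁ < n))
    rw [div_lt_iff₀ (by positivity)] at this
    linarith
  have hpos : (0 : ℝ) < (n : ℝ) ^ (s - t) := by positivity
  have hr1 : (1 : ℝ) ≤ r := by exact_mod_cast hr
  have hrs : (r : ℝ) ≤ n ^ s := by
    refine hrε.trans (mul_le_of_le_one_left (by positivity) (min_le_right _ _))
  have hrs' : (r : ℝ) ≤ ε * n ^ s :=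
    hrε.trans (mul_le_mul_of_nonneg_right (min_le_left _ _) (by positivity))
  obtain ⟨T, hTn, hT, hδ⟩ := hS n (by omega) F hF (by omega) (by
      have h1 : (((n - (t + 1)).choose s : ℕ) : ℝ) ≤ n ^ s := by
        exact_mod_cast (Nat.choose_le_pow _ s).trans (Nat.pow_le_pow_left (Nat.sub_le _ _) s)
      rw [hFc, Nat.cast_add]
      linarith) (by
      refine hlt.le.trans ?_
      have : c * r ≤ 1 * (ε * n ^ s) := mul_le_mul hc1 hrs' (by positivity) zero_le_one
      rw [one_mul] at this
      exact mul_le_mul_of_nonneg_right this hpos.le)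
  set star := ((Finset.Icc 1 n).powersetCard k).filter (fun G => T ⊆ G) with hstar
  have hstarc : star.card = (n - (t + 1)).choose s := by
    rw [hstar, card_filter_subset_powersetCard hTn (by omega), Nat.card_Icc, Nat.add_sub_cancel, hT]
    congr 1; omega
  set R := F.filter (fun G => ¬ T ⊆ G) with hR
  have hRD : R.card = (star \ F).card + r := by
    have h1 : (star \ F).card + (star ∩ F).card = star.card :=
      Finset.card_sdiff_add_card_inter star F
    have h2 : star ∩ F = F.filter (fun G => T ⊆ G) := by
      ext G
      rw [hstar, Finset.mem_inter, Finset.mem_filter, Finset.mem_filter]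
      exact ⟨fun h => ⟨h.2, h.1.2⟩, fun h => ⟨⟨hF h.1, h.2⟩, h.1⟩⟩
    have h3 : (F.filter (fun G => T ⊆ G)).card + R.card = F.card :=
      Finset.card_filter_add_card_filter_not _
    rw [h2] at h1
    omega
  set P : Finset ℕ → Prop := fun A =>
    ((F.filter (fun G => T ⊆ G ∧ (G ∩ A).card = t)).card : ℝ) ≤ b / 4 * n ^ (s - t) with hP
  have hsplit : (R.filter P).card + (R.filter (fun A => ¬ P A)).card = R.card :=
    Finset.card_filter_add_card_filter_not _
  have hRF : R ⊆ F := Finset.filter_subset _ _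
  have hnon : ((R.filter (fun A => ¬ P A)).card : ℝ) ≤ r / 2 := by
    have h1 := mul_card_le_orderedPairs (t := t) T
      ((Finset.filter_subset (fun A => ¬ P A) R).trans hRF) (b / 4 * n ^ (s - t))
      (fun A hA => (not_le.1 (Finset.mem_filter.1 hA).2).le)
    have h2 : ((R.filter (fun A => ¬ P A)).card : ℝ) * (b / 4 * n ^ (s - t))
        ≤ r / 2 * (b / 4 * n ^ (s - t)) := by
      calc _ = b / 4 * n ^ (s - t) * ((R.filter (fun A => ¬ P A)).card : ℝ) := by ring
        _ ≤ c * r * n ^ (s - t) := h1.trans hlt.le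
        _ ≤ b / 8 * r * n ^ (s - t) := by gcongr
        _ = _ := by ring
    exact le_of_mul_le_mul_right h2 (by positivity)
  have hRD' : (R.card : ℝ) = (star \ F).card + r := by exact_mod_cast hRD
  have hsplit' : ((R.filter P).card : ℝ) + (R.filter (fun A => ¬ P A)).card = R.card := by
    exact_mod_cast hsplit
  have hQF : R.filter P ⊆ F := (Finset.filter_subset _ _).trans hRF
  have hsh := card_levelShadow_mul_le hk (by omega) hn1 hF hQF hTn hT hb (hnb n (by omega)) hnk
    (fun A hA => (Finset.mem_filter.1 (Finset.mem_filter.1 hA).1).2)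
    (fun A hA => (Finset.mem_filter.1 hA).2)
  have hfin := hKL n (by omega) (R.filter P) (hQF.trans hF) _ le_rfl
    (by
      intro U _
      refine le_trans ?_ hδ
      exact_mod_cast Finset.card_le_card
        ((Finset.filter_subset _ _).trans (Finset.filter_subset _ _)))
    (by
      have h1 : (orderedPairs t (R.filter P) : ℝ) ≤ orderedPairs t F := by
        exact_mod_cast orderedPairs_mono t hQF
      have h2 : (r : ℝ) ≤ 2 * (R.filter P).card := by
        have : (0 : ℝ) ≤ (star \ F).card := by positivity
        linarith
      calc _ ≤ c * r * n ^ (s - t) := h1.trans hlt.le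
        _ ≤ cK / 2 * (2 * (R.filter P).card) * n ^ (s - t) := by gcongr
        _ = _ := by ring)
  have h1 : ((R.filter P).card : ℝ) ≤ (star \ F).card / 4 := by
    calc _ ≤ _ := hfin
      _ = 1 / (4 * K) * ((levelShadow t (R.filter P)).card * n ^ (s - t)) := by ring
      _ ≤ 1 / (4 * K) * (K * (star \ F).card) := by gcongr
      _ = _ := by field_simp
  have : (0 : ℝ) ≤ (star \ F).card := by positivity
  linarith

theorem orderedPairs_le_two_mul_rhoPairs {k t : ℕ} (htk : t < k) {F : Finset (Finset ℕ)}
    (hF : ∀ A ∈ F, A.card = k) : orderedPairs t F ≤ 2 * rhoPairs t F := by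
  refine Finset.card_le_mul_card_image_of_maps_to (f := fun p => ({p.1, p.2} : Finset (Finset ℕ)))
    ?_ 2 ?_
  · rintro ⟨A, B⟩ hp
    simp only [Finset.mem_filter, Finset.mem_product] at hp
    obtain ⟨⟨hA, hB⟩, hAB⟩ := hp
    have hne : A ≠ B := by
      rintro rfl
      rw [Finset.inter_self, hF A hA] at hAB
      omega
    refine Finset.mem_filter.2 ⟨Finset.mem_powersetCard.2 ⟨?_, Finset.card_pair hne⟩,
      A, by simp, B, by simp, hne, hAB⟩
    intro x hx
    simp only [Finset.mem_insert, Finset.mem_singleton] at hx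
    rcases hx with rfl | rfl <;> assumption
  · intro P hP
    obtain ⟨A, B, -, rfl⟩ :=
      Finset.card_eq_two.1 (Finset.mem_powersetCard.1 (Finset.mem_filter.1 hP).1).2
    refine (Finset.card_le_card (t := {(A, B), (B, A)}) ?_).trans Finset.card_le_two
    rintro ⟨C, D⟩ hp
    have h := (Finset.mem_filter.1 hp).2
    have h' : ({C, D} : Set (Finset ℕ)) = {A, B} := by
      simpa using congrArg (fun X : Finset (Finset ℕ) => (X : Set (Finset ℕ))) h
    rcases Set.pair_eq_pair_iff.1 h' with ⟨rfl, rfl⟩ | ⟨rfl, rfl⟩ <;> simp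

theorem rhoPairs_union_le {t : ℕ} {S R : Finset (Finset ℕ)}
    (hS : ∀ A ∈ S, ∀ B ∈ S, t < (A ∩ B).card) (hR : ∀ A ∈ R, ∀ B ∈ R, t < (A ∩ B).card) :
    rhoPairs t (S ∪ R) ≤ ∑ A ∈ R, (S.filter (fun B => (A ∩ B).card = t)).card := by
  have key : ((S ∪ R).powersetCard 2).filter
      (fun P => ∃ A ∈ P, ∃ B ∈ P, A ≠ B ∧ (A ∩ B).card = t) ⊆
      R.biUnion (fun A => (S.filter (fun B => (A ∩ B).card = t)).image (fun B => {A, B})) := by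
    intro P hP
    obtain ⟨hP, A, hA, B, hB, hne, hAB⟩ := Finset.mem_filter.1 hP
    obtain ⟨hPS, hP2⟩ := Finset.mem_powersetCard.1 hP
    have hPeq : ({A, B} : Finset (Finset ℕ)) = P := by
      refine Finset.eq_of_subset_of_card_le ?_ (by rw [hP2, Finset.card_pair hne])
      intro x hx
      simp only [Finset.mem_insert, Finset.mem_singleton] at hx
      rcases hx with rfl | rfl <;> assumption
    simp only [Finset.mem_biUnion, Finset.mem_image, Finset.mem_filter]
    rcases Finset.mem_union.1 (hPS hA) with hA' | hA' <;>
      rcases Finset.mem_union.1 (hPS hB) with hB' | hB'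
    · exact absurd hAB (hS A hA' B hB').ne'
    · exact ⟨B, hB', A, ⟨hA', by rwa [Finset.inter_comm]⟩, by rwa [Finset.pair_comm]⟩
    · exact ⟨A, hA', B, ⟨hB', hAB⟩, hPeq⟩
    · exact absurd hAB (hR A hA' B hB').ne'
  refine (Finset.card_le_card key).trans (Finset.card_biUnion_le.trans ?_)
  exact Finset.sum_le_sum fun A _ => Finset.card_image_le

theorem card_filter_inter_card_eq_le {n k t : ℕ} {S : Finset (Finset ℕ)}
    (hS : S ⊆ (Finset.Icc 1 n).powersetCard k) {T A : Finset ℕ} (hT : ∀ B ∈ S, T ⊆ B)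
    (hTA : Disjoint T A) :
    (S.filter (fun B => (A ∩ B).card = t)).card ≤ 2 ^ A.card * n ^ (k - (T.card + t)) := by
  have key : S.filter (fun B => (A ∩ B).card = t) ⊆
      (A.powersetCard t).biUnion (fun W => S.filter (fun B => T ∪ W ⊆ B)) := by
    intro B hB
    obtain ⟨hB, hAB⟩ := Finset.mem_filter.1 hB
    refine Finset.mem_biUnion.2 ⟨A ∩ B, Finset.mem_powersetCard.2 ⟨Finset.inter_subset_left, hAB⟩,
      Finset.mem_filter.2 ⟨hB, Finset.union_subset (hT B hB) Finset.inter_subset_right⟩⟩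
  refine (Finset.card_le_card key).trans ((Finset.card_biUnion_le_card_mul _ _ _ ?_).trans
    (Nat.mul_le_mul_right _ ?_))
  · intro W hW
    obtain ⟨hWA, hWt⟩ := Finset.mem_powersetCard.1 hW
    have := card_filter_subset_le (T ∪ W) hS
    rwa [Finset.card_union_of_disjoint (hTA.mono_right hWA), hWt] at this
  · rw [Finset.card_powersetCard]
    exact Nat.choose_le_two_pow _ _

theorem exists_family_rhoPairs_le {n k t s r : ℕ} (hk : k = t + 1 + s) (hn : 2 * t + 2 ≤ n)
    (hr : r ≤ (n - (2 * t + 2)).choose s) :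
    ∃ F ⊆ (Finset.Icc 1 n).powersetCard k, F.card = (n - (t + 1)).choose s + r ∧
      rhoPairs t F ≤ r * (2 ^ k * n ^ (s - t)) := by
  set T := Finset.Icc 1 (t + 1) with hT
  set U := Finset.Icc (t + 2) (2 * t + 2) with hU
  have hTc : T.card = t + 1 := by simp [hT]
  have hUc : U.card = t + 1 := by simp [hU]; omega
  set S := ((Finset.Icc 1 n).powersetCard k).filter (fun G => T ⊆ G) with hSdef
  have hSc : S.card = (n - (t + 1)).choose s := by
    rw [hSdef, card_filter_subset_powersetCard (Finset.Icc_subset_Icc le_rfl (by omega))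
      (hTc.trans_le (by omega)), hTc, Nat.card_Icc]
    congr 1
    omega
  obtain ⟨R, hRsub, hRc⟩ := Finset.exists_subset_card_eq
    (s := ((Finset.Icc (t + 2) n).powersetCard k).filter (fun G => U ⊆ G)) (n := r) (by
      rw [card_filter_subset_powersetCard (Finset.Icc_subset_Icc le_rfl (by omega))
        (hUc.trans_le (by omega)), hUc, Nat.card_Icc]
      refine hr.trans (le_of_eq ?_)
      congr 1 <;> omega)
  have hR : ∀ A ∈ R, A ⊆ Finset.Icc (t + 2) n ∧ A.card = k ∧ U ⊆ A := by
    intro A hA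
    have := Finset.mem_filter.1 (hRsub hA)
    exact ⟨(Finset.mem_powersetCard.1 this.1).1, (Finset.mem_powersetCard.1 this.1).2, this.2⟩
  have hTA : ∀ A ∈ R, Disjoint T A := by
    intro A hA
    refine Finset.disjoint_left.2 fun x hx hxA => ?_
    have h1 := Finset.mem_Icc.1 hx
    have h2 := Finset.mem_Icc.1 ((hR A hA).1 hxA)
    omega
  have hST : ∀ B ∈ S, T ⊆ B := fun B hB => (Finset.mem_filter.1 hB).2
  have hdisj : Disjoint S R := by
    refine Finset.disjoint_left.2 fun A hA hAR => ?_
    have h1 : (1 : ℕ) ∈ T := by simp [hT]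
    exact Finset.disjoint_left.1 (hTA A hAR) h1 (hST A hA h1)
  refine ⟨S ∪ R, Finset.union_subset (Finset.filter_subset _ _) ?_, ?_, ?_⟩
  · intro A hA
    exact Finset.mem_powersetCard.2
      ⟨(hR A hA).1.trans (Finset.Icc_subset_Icc (by omega) le_rfl), (hR A hA).2.1⟩
  · rw [Finset.card_union_of_disjoint hdisj, hSc, hRc]
  · refine (rhoPairs_union_le ?_ ?_).trans ?_
    · intro A hA B hB
      have := Finset.card_le_card (Finset.subset_inter (hST A hA) (hST B hB))
      omega
    · intro A hA B hB
      have := Finset.card_le_card (Finset.subset_inter (hR A hA).2.2 (hR B hB).2.2)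
      omega
    · refine (Finset.sum_le_card_nsmul R _ (2 ^ k * n ^ (s - t)) ?_).trans (by simp [hRc])
      intro A hA
      have := card_filter_inter_card_eq_le (t := t) (Finset.filter_subset _ _) hST (hTA A hA)
      rwa [(hR A hA).2.1, hTc, show k - (t + 1 + t) = s - t by omega] at this

/-- Theorem 5 (i): for `k ≥ 2t+3` and `r = o(n^{k-t-1})`,
`ρ(C(n-t-1,k-t-1) + r) = Θ(r ⋅ n^{k-2t-1})`. -/
theorem rho_thm5_i (k t : ℕ) (ht : 0 < t) (h : 2 * t + 3 ≤ k) :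
    ∃ c₁ c₂ : ℝ, 0 < c₁ ∧ 0 < c₂ ∧
      ∀ r : ℕ → ℕ, (∀ n, 1 ≤ r n) →
        Filter.Tendsto (fun n => (r n : ℝ) / (n : ℝ) ^ (k - t - 1))
          Filter.atTop (nhds 0) →
        ∃ n₀ : ℕ, ∀ n > n₀,
          c₁ * (r n : ℝ) * (n : ℝ) ^ (k - 2 * t - 1)
              ≤ (rhoMin n k t ((n - t - 1).choose (k - t - 1) + r n) : ℝ) ∧
          (rhoMin n k t ((n - t - 1).choose (k - t - 1) + r n) : ℝ)
              ≤ c₂ * (r n : ℝ) * (n : ℝ) ^ (k - 2 * t - 1) := by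
  obtain ⟨s, hs⟩ : ∃ s, s = k - t - 1 := ⟨_, rfl⟩
  have hk : k = t + 1 + s := by omega
  obtain ⟨c, hc, ε, hε, n₁, hlow⟩ := exists_mul_le_orderedPairs k t s ht hk (by omega)
  obtain ⟨n₂, hch⟩ := exists_forall_le_factorial_mul_choose (2 * t + 2) s (1 / 2) (by norm_num)
  refine ⟨c / 2, 2 ^ k, by positivity, by positivity, fun r hr hlim => ?_⟩
  rw [← hs, show k - 2 * t - 1 = s - t by omega]
  rw [← hs] at hlim
  have hfac : (0 : ℝ) < s.factorial := by exact_mod_cast s.factorial_pos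
  obtain ⟨n₃, hn₃⟩ := Filter.eventually_atTop.1
    (hlim.eventually_le_const (u := min ε (1 / (2 * s.factorial))) (by positivity))
  refine ⟨n₁ + n₂ + n₃ + 2 * t + 2, fun n hn => ?_⟩
  have hn0 : (0 : ℝ) < n := by
    have : 0 < n := by omega
    exact_mod_cast this
  have hrn := (div_le_iff₀ (by positivity)).1 (hn₃ n (by omega))
  have hrε : (r n : ℝ) ≤ ε * n ^ s := hrn.trans (by gcongr; exact min_le_left _ _)
  have hrc : r n ≤ (n - (2 * t + 2)).choose s := by
    have h1 : (r n : ℝ) ≤ 1 / (2 * s.factorial) * n ^ s :=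
      hrn.trans (by gcongr; exact min_le_right _ _)
    have h2 := hch n (by omega)
    have h3 : s.factorial * (r n : ℝ) ≤ s.factorial * ((n - (2 * t + 2)).choose s : ℕ) := by
      refine le_trans ?_ h2
      calc s.factorial * (r n : ℝ) ≤ s.factorial * (1 / (2 * s.factorial) * n ^ s) := by gcongr
        _ = (1 - 1 / 2) * (n : ℝ) ^ s := by field_simp; norm_num
    exact_mod_cast le_of_mul_le_mul_left h3 hfac
  rw [Nat.sub_sub]
  obtain ⟨F, hF, hFc, hFr⟩ := exists_family_rhoPairs_le hk (by omega) hrc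
  constructor
  · obtain ⟨F', hF', hFc', hFr'⟩ := Nat.sInf_mem (s := { m : ℕ | ∃ F : Finset (Finset ℕ),
      F ⊆ (Finset.Icc 1 n).powersetCard k ∧ F.card = (n - (t + 1)).choose s + r n ∧
        rhoPairs t F = m }) ⟨_, F, hF, hFc, rfl⟩
    have h1 := hlow n (by omega) (r n) (hr n) hrε F' hF' hFc'
    have h2 : (orderedPairs t F' : ℝ) ≤ 2 * rhoPairs t F' := by
      exact_mod_cast orderedPairs_le_two_mul_rhoPairs (by omega)
        fun A hA => (Finset.mem_powersetCard.1 (hF' hA)).2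
    rw [rhoMin, ← hFr']
    linarith
  · have h1 : rhoMin n k t ((n - (t + 1)).choose s + r n) ≤ r n * (2 ^ k * n ^ (s - t)) :=
      le_trans (Nat.sInf_le ⟨F, hF, hFc, rfl⟩) hFr
    calc (rhoMin n k t ((n - (t + 1)).choose s + r n) : ℝ) ≤ r n * (2 ^ k * n ^ (s - t)) := by
          exact_mod_cast h1
      _ = _ := by ring
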